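/- arXiv:0806.3926 — 2 statements merged into one kernel-verified Lean document; each statement's English description precedes it below -/
import Mathlib

section
/- The normalized Eisenstein series satisfy the Ramanujan relations: for every z in the upper half plane ℍ, g₁′(z) = g₁(z)² − (1/12)g₂(z), g₂′(z) = 4g₁(z)g₂(z) − 6g₃(z), and g₃′(z) = 6g₁(z)g₃(z) − (1/3)g₂(z)², where ′ denotes the complex derivative d/dz. -/
open Complex

/-- `σ_j(n) = Σ_{d ∣ n} d^j`, as a complex number. -/
noncomputable def sigmaC (j n : ℕ) : ℂ :=
  ∑ d ∈ Nat.divisors n, (d : ℂ) ^ j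

/-- The normalized Eisenstein series `g₁` of weight 2:
`g₁(z) = (2πi/12)(1 - 24 Σ_{n≥1} σ₁(n) e^{2πinz})`, where `-24 = (-1)^1·(4·1)/B₁`, `B₁ = 1/6`. -/
noncomputable def eisG₁ (z : ℂ) : ℂ :=
  (2 * Real.pi * I / 12) *
    (1 + (-1) ^ 1 * (4 * 1 / (1 / 6 : ℂ)) *
      ∑' n : ℕ+, sigmaC 1 n * Complex.exp (2 * Real.pi * I * n * z))

/-- The normalized Eisenstein series `g₂` of weight 4:
`g₂(z) = 12(2πi/12)²(1 + 240 Σ_{n≥1} σ₃(n) e^{2πinz})`, where `240 = (-1)^2·(4·2)/B₂`, `B₂ = 1/30`. -/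
noncomputable def eisG₂ (z : ℂ) : ℂ :=
  (12 * (2 * Real.pi * I / 12) ^ 2) *
    (1 + (-1) ^ 2 * (4 * 2 / (1 / 30 : ℂ)) *
      ∑' n : ℕ+, sigmaC 3 n * Complex.exp (2 * Real.pi * I * n * z))

/-- The normalized Eisenstein series `g₃` of weight 6:
`g₃(z) = 8(2πi/12)³(1 - 504 Σ_{n≥1} σ₅(n) e^{2πinz})`, where `-504 = (-1)^3·(4·3)/B₃`, `B₃ = 1/42`. -/
noncomputable def eisG₃ (z : ℂ) : ℂ :=
  (8 * (2 * Real.pi * I / 12) ^ 3) *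
    (1 + (-1) ^ 3 * (4 * 3 / (1 / 42 : ℂ)) *
      ∑' n : ℕ+, sigmaC 5 n * Complex.exp (2 * Real.pi * I * n * z))

section Helpers

open UpperHalfPlane hiding I
open EisensteinSeries ModularForm Derivative Filter Function
open scoped Real Manifold MatrixGroups Topology ArithmeticFunction.sigma

/-- A holomorphic level one form of weight less than `12` vanishing at infinity is zero. -/
lemma eq_zero_of_slash_eq_of_isZeroAtImInfty {k : ℤ} (hk : k < 12) {F : ℍ → ℂ} (hF : MDiff F)
    (hinv : ∀ γ : SL(2, ℤ), F ∣[k] γ = F) (h0 : IsZeroAtImInfty F) (z : ℍ) : F z = 0 := by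
  let f : CuspForm 𝒮ℒ k :=
    { toFun := F
      slash_action_eq' := fun _ ⟨γ, hγ⟩ ↦ hγ ▸ hinv γ
      holo' := hF
      zero_at_cusps' {c} hc := by
        rw [Subgroup.IsArithmetic.isCusp_iff_isCusp_SL2Z] at hc
        rw [OnePoint.isZeroAt_iff_forall_SL2Z hc]
        intro γ _
        exact (hinv γ).symm ▸ h0 }
  have hf : f = 0 := rank_zero_iff_forall_zero.mp (CuspForm.rank_eq_zero_of_weight_lt_twelve hk) f
  exact DFunLike.congr_fun hf z

section CuspLimits

variable {f : ℍ → ℂ}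

lemma tendsto_atImInfty_cuspFunction_zero (hper : Periodic (f ∘ ofComplex) (1 : ℝ)) (hf : MDiff f)
    (hbdd : IsBoundedAtImInfty f) :
    Tendsto f atImInfty (𝓝 (UpperHalfPlane.cuspFunction 1 f 0)) := by
  have hc := (analyticAt_cuspFunction_zero one_pos hper hf hbdd).continuousAt
  exact (hc.tendsto.comp (qParam_tendsto_atImInfty one_pos)).congr fun τ ↦
    eq_cuspFunction τ one_ne_zero hper

lemma normalizedDeriv_eq_qParam_mul_deriv_cuspFunction
    (hper : Periodic (f ∘ ofComplex) (1 : ℝ)) (hf : MDiff f)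
    (hbdd : IsBoundedAtImInfty f) (τ : ℍ) :
    D f τ = Periodic.qParam 1 τ *
      deriv (UpperHalfPlane.cuspFunction 1 f) (Periodic.qParam 1 τ) := by
  have hC := differentiableAt_cuspFunction one_pos hper hf hbdd
    (Periodic.norm_qParam_lt_one one_pos τ.im_pos)
  have hq : HasDerivAt (Periodic.qParam 1) (2 * π * I * Periodic.qParam 1 τ) (τ : ℂ) := by
    have hfun : Periodic.qParam 1 = fun w : ℂ ↦ cexp (2 * π * I * w) := by
      ext w
      simp [Periodic.qParam]
    rw [hfun]
    simpa [mul_comm] using ((hasDerivAt_id (τ : ℂ)).const_mul (2 * π * I)).cexp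
  have heq : f ∘ ofComplex =ᶠ[𝓝 (τ : ℂ)]
      UpperHalfPlane.cuspFunction 1 f ∘ Periodic.qParam 1 := by
    filter_upwards [isOpen_upperHalfPlaneSet.mem_nhds τ.im_pos] with w hw
    simpa [ofComplex_apply_of_im_pos hw] using
      (eq_cuspFunction (⟨w, hw⟩ : ℍ) one_ne_zero hper).symm
  rw [normalizedDerivOfComplex, heq.deriv_eq, (hC.hasDerivAt.comp (τ : ℂ) hq).deriv]
  field_simp [two_pi_I_ne_zero]

lemma isZeroAtImInfty_normalizedDeriv (hper : Periodic (f ∘ ofComplex) (1 : ℝ)) (hf : MDiff f)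
    (hbdd : IsBoundedAtImInfty f) : IsZeroAtImInfty (D f) := by
  have hc := (analyticAt_cuspFunction_zero one_pos hper hf hbdd).deriv.continuousAt
  have hq := qParam_tendsto_atImInfty (h := 1) one_pos
  have := hq.mul (hc.tendsto.comp hq)
  rw [zero_mul] at this
  exact this.congr fun τ ↦ (normalizedDeriv_eq_qParam_mul_deriv_cuspFunction hper hf hbdd τ).symm

end CuspLimits

section LevelOne

variable {k : ℕ} (hk : 3 ≤ k)

lemma E_periodic : Periodic ((E hk : ℍ → ℂ) ∘ ofComplex) (1 : ℝ) :=
  SlashInvariantFormClass.periodic_comp_ofComplex (E hk) one_mem_strictPeriods_SL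

lemma E_isBoundedAtImInfty : IsBoundedAtImInfty (E hk) :=
  haveI : Fact (IsCusp OnePoint.infty 𝒮ℒ) :=
    ⟨Subgroup.isCusp_of_mem_strictPeriods one_pos one_mem_strictPeriods_SL⟩
  ModularFormClass.bdd_at_infty (E hk)

lemma tendsto_E_atImInfty (hk2 : Even k) : Tendsto (E hk) atImInfty (𝓝 1) := by
  have h := tendsto_atImInfty_cuspFunction_zero (E_periodic hk) (ModularFormClass.holo (E hk))
    (E_isBoundedAtImInfty hk)
  have h0 := E_qExpansion_coeff_zero hk hk2
  simp only [UpperHalfPlane.qExpansion_coeff, Nat.factorial_zero, Nat.cast_one, inv_one, one_mul,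
    iteratedDeriv_zero] at h0
  rwa [h0] at h

lemma E_slash (γ : SL(2, ℤ)) : (E hk : ℍ → ℂ) ∣[(k : ℤ)] γ = E hk :=
  SlashInvariantFormClass.slash_action_eq (E hk) (γ : GL (Fin 2) ℝ) ⟨γ, rfl⟩

lemma isZeroAtImInfty_normalizedDeriv_E : IsZeroAtImInfty (D (E hk)) :=
  isZeroAtImInfty_normalizedDeriv (E_periodic hk) (ModularFormClass.holo (E hk))
    (E_isBoundedAtImInfty hk)

end LevelOne

section WeightTwo

lemma hasSum_qParam_E2 (τ : ℍ) :
    HasSum (fun m : ℕ ↦ (if m = 0 then 1 else -24 * σ 1 m : ℂ) • Periodic.qParam 1 τ ^ m)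
      (E2 τ) := by
  simpa [Periodic.qParam] using hasSum_qExpansion_E2 τ

lemma E2_periodic : Periodic (E2 ∘ ofComplex) (1 : ℝ) := by
  intro w
  by_cases hw : 0 < w.im
  · have hw' : 0 < (w + (1 : ℝ)).im := by simpa using hw
    simp only [comp_apply, ofComplex_apply_of_im_pos hw, ofComplex_apply_of_im_pos hw']
    refine (hasSum_qParam_E2 _).unique ?_
    have := hasSum_qParam_E2 ⟨w, hw⟩
    have hq : Periodic.qParam 1 (w + (1 : ℝ)) = Periodic.qParam 1 w :=
      by simp [Periodic.qParam, mul_add, Complex.exp_add]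
    simpa only [coe_mk, hq] using this
  · have hw' : ¬ 0 < (w + (1 : ℝ)).im := by simpa using hw
    simp only [comp_apply, ofComplex_apply_of_im_nonpos (not_lt.mp hw),
      ofComplex_apply_of_im_nonpos (not_lt.mp hw')]

lemma tendsto_E2_atImInfty : Tendsto E2 atImInfty (𝓝 1) := by
  have h := tendsto_atImInfty_cuspFunction_zero E2_periodic E2_mdifferentiable
    isBoundedAtImInfty_E2
  have hs := hasFPowerSeriesOnBall_cuspFunction one_pos
    (analyticAt_cuspFunction_zero one_pos E2_periodic E2_mdifferentiable isBoundedAtImInfty_E2)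
    hasSum_qParam_E2
  have h0 := hs.coeff_zero (fun _ ↦ 0)
  simp only [FormalMultilinearSeries.ofScalars_apply_eq] at h0
  simpa [← h0] using h

lemma isZeroAtImInfty_normalizedDeriv_E2 : IsZeroAtImInfty (D E2) :=
  isZeroAtImInfty_normalizedDeriv E2_periodic E2_mdifferentiable isBoundedAtImInfty_E2

lemma hasDerivAt_D2_comp_ofComplex (γ : SL(2, ℤ)) (z : ℍ) :
    HasDerivAt (D2 γ ∘ ofComplex) (-(2 * π * I) * ((γ 1 0 : ℂ) / denom γ z) ^ 2) z := by
  have hz := denom_ne_zero (γ : GL (Fin 2) ℝ) z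
  have h := (hasDerivAt_denom_zpow (γ : GL (Fin 2) ℝ) (-1) z).const_mul (2 * π * I * γ 1 0)
  refine (h.congr_of_eventuallyEq ?_).congr_deriv ?_
  · filter_upwards [isOpen_upperHalfPlaneSet.mem_nhds z.im_pos] with w hw
    simp [D2, ofComplex_apply_of_im_pos hw, div_eq_mul_inv]
  · simp only [show (-1 - 1 : ℤ) = -2 by norm_num, zpow_neg]
    simp
    field_simp

lemma mdifferentiable_D2 (γ : SL(2, ℤ)) : MDiff (D2 γ) := fun z ↦
  mdifferentiableAt_iff.mpr (hasDerivAt_D2_comp_ofComplex γ z).differentiableAt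

lemma normalizedDeriv_D2 (γ : SL(2, ℤ)) (z : ℍ) :
    D (D2 γ) z = -((γ 1 0 : ℂ) / denom γ z) ^ 2 := by
  rw [normalizedDerivOfComplex, (hasDerivAt_D2_comp_ofComplex γ z).deriv]
  field_simp [two_pi_I_ne_zero]

lemma normalizedDeriv_E2_sub_sq_slash (γ : SL(2, ℤ)) :
    (D E2 - (12⁻¹ : ℂ) • (E2 * E2)) ∣[(4 : ℤ)] γ = D E2 - (12⁻¹ : ℂ) • (E2 * E2) := by
  have hsplit : D E2 - (12⁻¹ : ℂ) • (E2 * E2) =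
      serreDerivative (2 : ℤ) E2 + (12⁻¹ : ℂ) • (E2 * E2) := by
    ext z
    simp
    ring
  have hserre : serreDerivative (2 : ℤ) E2 ∣[(4 : ℤ)] γ =
      serreDerivative (2 : ℤ) (E2 ∣[(2 : ℤ)] γ) :=
    serreDerivative_slash_equivariant (k := 2) E2_mdifferentiable
  have hmul : (E2 * E2) ∣[(4 : ℤ)] γ = (E2 ∣[(2 : ℤ)] γ) * (E2 ∣[(2 : ℤ)] γ) :=
    mul_slash_SL2 2 2 γ E2 E2
  rw [hsplit, SlashAction.add_slash, SL_smul_slash, hserre, hmul, E2_slash_action, ← hsplit]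
  ext z
  simp only [Pi.add_apply, Pi.sub_apply, Pi.smul_apply, Pi.mul_apply, smul_eq_mul,
    serreDerivative_apply]
  rw [normalizedDerivOfComplex_sub _ _ E2_mdifferentiable ((mdifferentiable_D2 γ).const_smul _),
    normalizedDerivOfComplex_smul _ _ (mdifferentiable_D2 γ)]
  simp only [Pi.sub_apply, Pi.smul_apply, smul_eq_mul, normalizedDeriv_D2, riemannZeta_two]
  have hpi : (π : ℂ) ≠ 0 := by exact_mod_cast Real.pi_ne_zero
  simp only [D2]
  have hz := denom_ne_zero (γ : GL (Fin 2) ℝ) z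
  field_simp
  ring_nf
  simp only [I_sq]
  ring

end WeightTwo

section RamanujanIdentities

lemma normalizedDeriv_E2 (z : ℍ) : D E2 z = (E2 z ^ 2 - E₄ z) / 12 := by
  have hE4 : MDiff (E₄ : ℍ → ℂ) := ModularFormClass.holo E₄
  have h := eq_zero_of_slash_eq_of_isZeroAtImInfty (k := 4) (by norm_num)
    (F := D E2 - (12⁻¹ : ℂ) • (E2 * E2) + (12⁻¹ : ℂ) • (E₄ : ℍ → ℂ))
    (((normalizedDerivOfComplex_mdifferentiable E2_mdifferentiable).sub
      ((E2_mdifferentiable.mul E2_mdifferentiable).const_smul _)).add (hE4.const_smul _))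
    (fun γ ↦ by
      have h4 : (E₄ : ℍ → ℂ) ∣[(4 : ℤ)] γ = E₄ := E_slash (k := 4) _ γ
      rw [SlashAction.add_slash, normalizedDeriv_E2_sub_sq_slash, SL_smul_slash, h4])
    (by
      have h4 := tendsto_E_atImInfty (k := 4) (by norm_num) (by decide)
      have h := (isZeroAtImInfty_normalizedDeriv_E2.sub
        ((tendsto_E2_atImInfty.mul tendsto_E2_atImInfty).const_smul (12⁻¹ : ℂ))).add
        (h4.const_smul (12⁻¹ : ℂ))
      rwa [show (0 : ℂ) - (12⁻¹ : ℂ) • (1 * 1) + (12⁻¹ : ℂ) • 1 = 0 by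
        norm_num] at h) z
  simp only [Pi.add_apply, Pi.sub_apply, Pi.smul_apply, Pi.mul_apply, smul_eq_mul] at h
  linear_combination h

lemma normalizedDeriv_E₄ (z : ℍ) : D E₄ z = (E2 z * E₄ z - E₆ z) / 3 := by
  have hE4 : MDiff (E₄ : ℍ → ℂ) := ModularFormClass.holo E₄
  have hE6 : MDiff (E₆ : ℍ → ℂ) := ModularFormClass.holo E₆
  have h := eq_zero_of_slash_eq_of_isZeroAtImInfty (k := 6) (by norm_num)
    (F := serreDerivative (4 : ℤ) E₄ + (3⁻¹ : ℂ) • (E₆ : ℍ → ℂ))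
    ((serreDerivative_mdifferentiable _ hE4).add (hE6.const_smul _))
    (fun γ ↦ by
      have h4 : serreDerivative (4 : ℤ) E₄ ∣[(6 : ℤ)] γ = serreDerivative (4 : ℤ) E₄ :=
        serreDerivative_slash_invariant (k := 4) hE4 (E_slash (k := 4) _ γ)
      have h6 : (E₆ : ℍ → ℂ) ∣[(6 : ℤ)] γ = E₆ := E_slash (k := 6) _ γ
      rw [SlashAction.add_slash, h4, SL_smul_slash, h6])
    (by
      have h4 := tendsto_E_atImInfty (k := 4) (by norm_num) (by decide)
      have h6 := tendsto_E_atImInfty (k := 6) (by norm_num) (by decide)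
      have h := ((isZeroAtImInfty_normalizedDeriv_E (k := 4) (by norm_num)).sub
        ((tendsto_E2_atImInfty.const_mul (((4 : ℤ) : ℂ) * 12⁻¹)).mul h4)).add
        (h6.const_smul (3⁻¹ : ℂ))
      rwa [show (0 : ℂ) - ((4 : ℤ) : ℂ) * 12⁻¹ * 1 * 1 + (3⁻¹ : ℂ) • 1 = 0 by
        norm_num] at h) z
  simp only [Pi.add_apply, Pi.smul_apply, smul_eq_mul, serreDerivative_apply] at h
  push_cast at h
  linear_combination h

lemma normalizedDeriv_E₆ (z : ℍ) : D E₆ z = (E2 z * E₆ z - E₄ z ^ 2) / 2 := by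
  have hE4 : MDiff (E₄ : ℍ → ℂ) := ModularFormClass.holo E₄
  have hE6 : MDiff (E₆ : ℍ → ℂ) := ModularFormClass.holo E₆
  have h := eq_zero_of_slash_eq_of_isZeroAtImInfty (k := 8) (by norm_num)
    (F := serreDerivative (6 : ℤ) E₆ + (2⁻¹ : ℂ) • ((E₄ : ℍ → ℂ) * (E₄ : ℍ → ℂ)))
    ((serreDerivative_mdifferentiable _ hE6).add ((hE4.mul hE4).const_smul _))
    (fun γ ↦ by
      have h6 : serreDerivative (6 : ℤ) E₆ ∣[(8 : ℤ)] γ = serreDerivative (6 : ℤ) E₆ :=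
        serreDerivative_slash_invariant (k := 6) hE6 (E_slash (k := 6) _ γ)
      have h4 : (E₄ : ℍ → ℂ) ∣[(4 : ℤ)] γ = E₄ := E_slash (k := 4) _ γ
      have h44 : ((E₄ : ℍ → ℂ) * (E₄ : ℍ → ℂ)) ∣[(8 : ℤ)] γ = (E₄ : ℍ → ℂ) * (E₄ : ℍ → ℂ) := by
        have := mul_slash_SL2 4 4 γ (E₄ : ℍ → ℂ) E₄
        rwa [h4] at this
      rw [SlashAction.add_slash, h6, SL_smul_slash, h44])
    (by
      have h4 := tendsto_E_atImInfty (k := 4) (by norm_num) (by decide)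
      have h6 := tendsto_E_atImInfty (k := 6) (by norm_num) (by decide)
      have h := ((isZeroAtImInfty_normalizedDeriv_E (k := 6) (by norm_num)).sub
        ((tendsto_E2_atImInfty.const_mul (((6 : ℤ) : ℂ) * 12⁻¹)).mul h6)).add
        ((h4.mul h4).const_smul (2⁻¹ : ℂ))
      rwa [show (0 : ℂ) - ((6 : ℤ) : ℂ) * 12⁻¹ * 1 * 1 + (2⁻¹ : ℂ) • (1 * 1) = 0 by
        norm_num] at h) z
  simp only [Pi.add_apply, Pi.smul_apply, Pi.mul_apply, smul_eq_mul, serreDerivative_apply] at h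
  push_cast at h
  linear_combination h

end RamanujanIdentities

section Comparison

lemma sigmaC_eq (j n : ℕ) : sigmaC j n = (σ j n : ℂ) := by
  simp [sigmaC, ArithmeticFunction.sigma_apply]

lemma cexp_two_pi_I_mul_nat_mul (n : ℕ) (z : ℂ) :
    cexp (2 * π * I * n * z) = cexp (2 * π * I * z) ^ n := by
  rw [← Complex.exp_nat_mul]
  ring_nf

lemma eisG₁_coe (z : ℍ) : eisG₁ z = 2 * π * I / 12 * E2 z := by
  simp only [eisG₁, E2_eq_tsum_cexp, sigmaC_eq, cexp_two_pi_I_mul_nat_mul]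
  ring

lemma eisG₂_coe (z : ℍ) : eisG₂ z = 12 * (2 * π * I / 12) ^ 2 * E₄ z := by
  have hB : bernoulli 4 = -1 / 30 := by decide +kernel
  rw [q_expansion_bernoulli _ (by decide), hB]
  simp only [eisG₂, sigmaC_eq, cexp_two_pi_I_mul_nat_mul, zpow_natCast]
  norm_num

lemma eisG₃_coe (z : ℍ) : eisG₃ z = 8 * (2 * π * I / 12) ^ 3 * E₆ z := by
  have hB : bernoulli 6 = 1 / 42 := by decide +kernel
  rw [q_expansion_bernoulli _ (by decide), hB]
  simp only [eisG₃, sigmaC_eq, cexp_two_pi_I_mul_nat_mul, zpow_natCast]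
  norm_num
  ring

lemma hasDerivAt_of_coe_eq_const_mul {g : ℂ → ℂ} {c : ℂ} {F : ℍ → ℂ} (hF : MDiff F)
    (hg : ∀ z : ℍ, g z = c * F z) (z : ℍ) : HasDerivAt g (2 * π * I * c * D F z) z := by
  have h := ((mdifferentiableAt_iff.mp (hF z)).hasDerivAt).const_mul c
  refine (h.congr_of_eventuallyEq ?_).congr_deriv ?_
  · filter_upwards [isOpen_upperHalfPlaneSet.mem_nhds z.im_pos] with w hw
    simpa [ofComplex_apply_of_im_pos hw] using hg ⟨w, hw⟩
  · rw [normalizedDerivOfComplex]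
    field_simp [two_pi_I_ne_zero]

end Comparison

end Helpers

/-- **The Ramanujan relations.** For every `z` in the upper half plane,
`g₁′ = g₁² − g₂/12`, `g₂′ = 4g₁g₂ − 6g₃`, `g₃′ = 6g₁g₃ − g₂²/3`. -/
theorem ramanujan_relations (z : ℂ) (hz : 0 < z.im) :
    HasDerivAt eisG₁ (eisG₁ z ^ 2 - (1 / 12) * eisG₂ z) z ∧
    HasDerivAt eisG₂ (4 * eisG₁ z * eisG₂ z - 6 * eisG₃ z) z ∧
    HasDerivAt eisG₃ (6 * eisG₁ z * eisG₃ z - (1 / 3) * eisG₂ z ^ 2) z := by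
  lift z to UpperHalfPlane using hz
  rw [eisG₁_coe, eisG₂_coe, eisG₃_coe]
  refine ⟨(hasDerivAt_of_coe_eq_const_mul E2_mdifferentiable eisG₁_coe z).congr_deriv ?_,
    (hasDerivAt_of_coe_eq_const_mul (ModularFormClass.holo ModularForm.E₄) eisG₂_coe
      z).congr_deriv ?_,
    (hasDerivAt_of_coe_eq_const_mul (ModularFormClass.holo ModularForm.E₆) eisG₃_coe
      z).congr_deriv ?_⟩
  · rw [normalizedDeriv_E2]
    ring
  · rw [normalizedDeriv_E₄]
    ring
  · rw [normalizedDeriv_E₆]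
    ring
end

section
/- No point of the zero locus of the elliptic integral has all coordinates algebraic: for every z in the upper half plane ℍ and every λ ∈ ℂ*, at least one of the three numbers λ²g₁(z), λ⁴g₂(z), λ⁶g₃(z) is transcendental. Equivalently, K ∩ (algebraic numbers)³ = ∅, where K = {(λ²g₁(z), λ⁴g₂(z), λ⁶g₃(z)) : z ∈ ℍ, λ ∈ ℂ*} is the set of parameters t for which some nonzero cycle δ ∈ H₁(E_t,ℤ) satisfies ∫_δ x dx/y = 0. -/
open Complex

namespace EllipticZeroLocus

/-- The value at the base point `(F, X, Y) = (0, e, 0)` of the `k`-th iterate of the derivation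
`F ↦ -X`, `X ↦ Y`, `Y ↦ 6 X² + p X + q` applied to the monomial `F ^ i * X ^ j * Y ^ l`. -/
def jet {R : Type*} [CommRing R] (p q e : R) : ℕ → ℕ → ℕ → ℕ → R
  | 0, i, j, l => 0 ^ i * e ^ j * 0 ^ l
  | k + 1, i, j, l =>
      -(i : R) * jet p q e k (i - 1) (j + 1) l + (j : R) * jet p q e k i (j - 1) (l + 1) +
        (l : R) * (6 * jet p q e k i (j + 2) (l - 1) + p * jet p q e k i (j + 1) (l - 1) +
          q * jet p q e k i j (l - 1))

lemma map_jet {R S : Type*} [CommRing R] [CommRing S] (φ : R →+* S) (p q e : R) (k i j l : ℕ) :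
    φ (jet p q e k i j l) = jet (φ p) (φ q) (φ e) k i j l := by
  induction k generalizing i j l with
  | zero => simp [jet]
  | succ k ih => simp [jet, ih, map_ofNat φ 6]

lemma norm_jet_le {p q e : ℂ} {H : ℝ} (hH : 1 ≤ H) (hp : ‖p‖ ≤ H) (hq : ‖q‖ ≤ H) (he : ‖e‖ ≤ H)
    (k d i j l : ℕ) (hd : i + j + l ≤ d) :
    ‖jet p q e k i j l‖ ≤ (8 * H) ^ k * ((d + k : ℕ) : ℝ) ^ k * H ^ (d + k) := by
  induction k generalizing d i j l with
  | zero =>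
    have h0 : ∀ n : ℕ, ‖(0 : ℂ) ^ n‖ ≤ 1 := fun n => by
      rw [norm_pow, norm_zero]; exact pow_le_one₀ le_rfl zero_le_one
    simp only [jet, norm_mul, pow_zero, one_mul, add_zero]
    calc ‖(0 : ℂ) ^ i‖ * ‖e ^ j‖ * ‖(0 : ℂ) ^ l‖ ≤ 1 * H ^ j * 1 := by
          gcongr
          · exact h0 i
          · rw [norm_pow]; gcongr
          · exact h0 l
      _ ≤ H ^ d := by
          rw [one_mul, mul_one]
          exact pow_le_pow_right₀ hH (by omega)
  | succ k ih =>
    set B : ℝ := (8 * H) ^ k * ((d + 1 + k : ℕ) : ℝ) ^ k * H ^ (d + 1 + k) with hB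
    have hB0 : 0 ≤ B := by positivity
    have key : ∀ i' j' l', i' + j' + l' ≤ d + 1 → ‖jet p q e k i' j' l'‖ ≤ B :=
      fun i' j' l' h => ih (d + 1) i' j' l' h
    have h1 : ‖-(i : ℂ) * jet p q e k (i - 1) (j + 1) l‖ ≤ i * (8 * H * B) := by
      rw [norm_mul, norm_neg, Complex.norm_natCast]
      gcongr
      exact (key _ _ _ (by omega)).trans (by nlinarith)
    have h2 : ‖(j : ℂ) * jet p q e k i (j - 1) (l + 1)‖ ≤ j * (8 * H * B) := by
      rcases Nat.eq_zero_or_pos j with rfl | hj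
      · simp
      rw [norm_mul, Complex.norm_natCast]
      gcongr
      exact (key _ _ _ (by omega)).trans (by nlinarith)
    have h3 : ‖(l : ℂ) * (6 * jet p q e k i (j + 2) (l - 1) + p * jet p q e k i (j + 1) (l - 1) +
          q * jet p q e k i j (l - 1))‖ ≤ l * (8 * H * B) := by
      rcases Nat.eq_zero_or_pos l with rfl | hl
      · simp
      rw [norm_mul, Complex.norm_natCast]
      gcongr
      refine (norm_add₃_le).trans ?_
      rw [norm_mul, norm_mul, norm_mul]
      have e1 := key i (j + 2) (l - 1) (by omega)
      have e2 := key i (j + 1) (l - 1) (by omega)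
      have e3 := key i j (l - 1) (by omega)
      have e4 : ‖p‖ * ‖jet p q e k i (j + 1) (l - 1)‖ ≤ H * B := by gcongr
      have e5 : ‖q‖ * ‖jet p q e k i j (l - 1)‖ ≤ H * B := by gcongr
      have e6 : ‖(6 : ℂ)‖ = 6 := by simp
      rw [e6]
      nlinarith
    calc ‖jet p q e (k + 1) i j l‖ ≤ i * (8 * H * B) + j * (8 * H * B) + l * (8 * H * B) := by
          rw [jet]
          exact norm_add₃_le.trans (by gcongr)
      _ = ((i + j + l : ℕ) : ℝ) * (8 * H * B) := by push_cast; ring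
      _ ≤ ((d + (k + 1) : ℕ) : ℝ) * (8 * H * B) :=
          mul_le_mul_of_nonneg_right (by exact_mod_cast (by omega)) (by positivity)
      _ = (8 * H) ^ (k + 1) * ((d + (k + 1) : ℕ) : ℝ) ^ (k + 1) * H ^ (d + (k + 1)) := by
          rw [hB, show d + 1 + k = d + (k + 1) by ring]; ring

/-- The period pair `(1, τ)`. -/
noncomputable def pair (τ : ℂ) (h : 0 < τ.im) : PeriodPair where
  ω₁ := 1
  ω₂ := τ
  indep := by
    rw [LinearIndependent.pair_iff]
    intro s t hst
    have him := congrArg Complex.im hst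
    have hre := congrArg Complex.re hst
    simp at him hre
    rcases him with h0 | h0
    · subst h0; simpa using hre
    · exact absurd h0 h.ne'

lemma mem_pair_lattice {τ : ℂ} {h : 0 < τ.im} {u : ℂ} :
    u ∈ (pair τ h).lattice ↔ ∃ m n : ℤ, m + n * τ = u := by
  rw [PeriodPair.mem_lattice]; simp [pair]

/-- A solution `(F, X, Y)` on `ℂ ∖ (ℤ + ℤτ)` of the system `c F' = -X`, `c X' = Y`,
`c Y' = 6 X² + p X + q`, where `X` is elliptic and `F` quasi-elliptic. -/
structure QuasiEllipticSystem (τ : ℂ) (hτ : 0 < τ.im) (F X Y : ℂ → ℂ) (c p q e κ : ℂ) : Prop where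
  c_ne : c ≠ 0
  κ_ne : κ ≠ 0
  hasDerivAt_F : ∀ u ∉ (pair τ hτ).lattice, HasDerivAt F (-X u / c) u
  hasDerivAt_X : ∀ u ∉ (pair τ hτ).lattice, HasDerivAt X (Y u / c) u
  hasDerivAt_Y : ∀ u ∉ (pair τ hτ).lattice, HasDerivAt Y ((6 * X u ^ 2 + p * X u + q) / c) u
  F_add_one : ∀ u, F (u + 1) = F u
  X_add_one : ∀ u, X (u + 1) = X u
  F_add_tau : ∀ u ∉ (pair τ hτ).lattice, F (u + τ) = F u + κ
  X_add_tau : ∀ u, X (u + τ) = X u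
  F_half : F (1 / 2) = 0
  X_half : X (1 / 2) = e
  Y_half : Y (1 / 2) = 0
  F_pole : ∃ g, AnalyticAt ℂ g 0 ∧ (fun u => u * F u) =ᶠ[nhdsWithin 0 {0}ᶜ] g
  X_pole : ∃ g, AnalyticAt ℂ g 0 ∧ (fun u => u ^ 2 * X u) =ᶠ[nhdsWithin 0 {0}ᶜ] g
  X_tendsto : Filter.Tendsto X (nhdsWithin 0 {0}ᶜ) (Bornology.cobounded ℂ)

open Filter Topology

lemma isOpen_compl_lattice (L : PeriodPair) : IsOpen ((L.lattice : Set ℂ)ᶜ) :=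
  L.isClosed_lattice.isOpen_compl

lemma half_notMem_lattice {τ : ℂ} (hτ : 0 < τ.im) : (1 / 2 : ℂ) ∉ (pair τ hτ).lattice :=
  (pair τ hτ).ω₁_div_two_notMem_lattice

lemma isPreconnected_compl_lattice (L : PeriodPair) : IsPreconnected ((L.lattice : Set ℂ)ᶜ) := by
  have hc : (L.lattice : Set ℂ).Countable := by
    have : Countable L.lattice := L.latticeEquivProd.injective.countable
    exact Set.countable_coe_iff.mp this
  exact (hc.isConnected_compl_of_one_lt_rank (by simp [Complex.rank_real_complex])).isPreconnected

namespace QuasiEllipticSystem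

variable {τ : ℂ} {hτ : 0 < τ.im} {F X Y : ℂ → ℂ} {c p q e κ : ℂ}
  (sys : QuasiEllipticSystem τ hτ F X Y c p q e κ)
include sys

lemma analyticAt_F {u : ℂ} (hu : u ∉ (pair τ hτ).lattice) : AnalyticAt ℂ F u := by
  have : DifferentiableOn ℂ F ((pair τ hτ).lattice : Set ℂ)ᶜ := fun v hv =>
    (sys.hasDerivAt_F v hv).differentiableAt.differentiableWithinAt
  exact this.analyticOnNhd (isOpen_compl_lattice _) u hu

lemma analyticAt_X {u : ℂ} (hu : u ∉ (pair τ hτ).lattice) : AnalyticAt ℂ X u := by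
  have : DifferentiableOn ℂ X ((pair τ hτ).lattice : Set ℂ)ᶜ := fun v hv =>
    (sys.hasDerivAt_X v hv).differentiableAt.differentiableWithinAt
  exact this.analyticOnNhd (isOpen_compl_lattice _) u hu

lemma analyticAt_Y {u : ℂ} (hu : u ∉ (pair τ hτ).lattice) : AnalyticAt ℂ Y u := by
  have : DifferentiableOn ℂ Y ((pair τ hτ).lattice : Set ℂ)ᶜ := fun v hv =>
    (sys.hasDerivAt_Y v hv).differentiableAt.differentiableWithinAt
  exact this.analyticOnNhd (isOpen_compl_lattice _) u hu

lemma contDiffAt_monomial (n : WithTop ℕ∞) (i j l : ℕ) :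
    ContDiffAt ℂ n (fun u => F u ^ i * X u ^ j * Y u ^ l) (1 / 2) := by
  have hu := half_notMem_lattice hτ
  have h1 := sys.analyticAt_F hu
  have h2 := sys.analyticAt_X hu
  have h3 := sys.analyticAt_Y hu
  exact (AnalyticAt.contDiffAt (by fun_prop))

lemma deriv_monomial {u : ℂ} (hu : u ∉ (pair τ hτ).lattice) (i j l : ℕ) :
    c * deriv (fun u => F u ^ i * X u ^ j * Y u ^ l) u =
      -(i : ℂ) * (F u ^ (i - 1) * X u ^ (j + 1) * Y u ^ l) +
      (j : ℂ) * (F u ^ i * X u ^ (j - 1) * Y u ^ (l + 1)) +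
      ((6 * l) * (F u ^ i * X u ^ (j + 2) * Y u ^ (l - 1)) +
      (l * p) * (F u ^ i * X u ^ (j + 1) * Y u ^ (l - 1)) +
      (l * q) * (F u ^ i * X u ^ j * Y u ^ (l - 1))) := by
  have h := (((sys.hasDerivAt_F u hu).fun_pow i).fun_mul
    ((sys.hasDerivAt_X u hu).fun_pow j)).fun_mul
    ((sys.hasDerivAt_Y u hu).fun_pow l)
  rw [h.deriv]
  have := sys.c_ne
  field_simp
  ring

lemma iteratedDeriv_monomial (k i j l : ℕ) :
    c ^ k * iteratedDeriv k (fun u => F u ^ i * X u ^ j * Y u ^ l) (1 / 2) =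
      jet p q e k i j l := by
  induction k generalizing i j l with
  | zero => rw [pow_zero, one_mul, iteratedDeriv_zero, sys.F_half, sys.X_half, sys.Y_half, jet]
  | succ k ih =>
    have hc := sys.c_ne
    have hev : (fun u => c * deriv (fun u => F u ^ i * X u ^ j * Y u ^ l) u) =ᶠ[𝓝 (1 / 2)] _ :=
      ((isOpen_compl_lattice _).eventually_mem (half_notMem_lattice hτ)).mono
        fun u hu => sys.deriv_monomial hu i j l
    have h := hev.iteratedDeriv_eq k
    have hcd := fun i j l => sys.contDiffAt_monomial k i j l
    have hcd' := fun (a : ℂ) i j l => (contDiffAt_const (c := a)).mul (hcd i j l)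
    rw [iteratedDeriv_const_mul_field, iteratedDeriv_fun_add, iteratedDeriv_fun_add,
      iteratedDeriv_fun_add, iteratedDeriv_fun_add] at h
    · simp only [iteratedDeriv_const_mul_field] at h
      rw [iteratedDeriv_succ', pow_succ, mul_assoc, h, jet, ← ih, ← ih, ← ih, ← ih, ← ih]
      ring
    all_goals
      first
        | exact hcd' _ _ _ _
        | exact (hcd' _ _ _ _).add (hcd' _ _ _ _)
        | exact ((hcd' _ _ _ _).add (hcd' _ _ _ _)).add (hcd' _ _ _ _)

lemma X_sub_int (u : ℂ) (n : ℤ) : X (u - n) = X u := by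
  have h : Function.Periodic X 1 := sys.X_add_one
  simpa using h.sub_int_mul_eq n (x := u)

lemma F_sub_int (u : ℂ) (n : ℤ) : F (u - n) = F u := by
  have h : Function.Periodic F 1 := sys.F_add_one
  simpa using h.sub_int_mul_eq n (x := u)

lemma X_add_int_mul_tau (u : ℂ) (n : ℤ) : X (u + n * τ) = X u := by
  have h : Function.Periodic X τ := sys.X_add_tau
  simpa using h.int_mul n u

lemma F_add_int_mul_tau {u : ℂ} (hu : u ∉ (pair τ hτ).lattice) (n : ℤ) :
    F (u + n * τ) = F u + n * κ := by
  have hmem : ∀ n : ℤ, u + n * τ ∉ (pair τ hτ).lattice := fun n hn => hu <| by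
    obtain ⟨a, b, h⟩ := mem_pair_lattice.mp hn
    exact mem_pair_lattice.mpr ⟨a, b - n, by push_cast; linear_combination h⟩
  induction n using Int.induction_on with
  | zero => simp
  | succ n ih =>
    have := sys.F_add_tau _ (hmem n)
    rw [ih] at this
    push_cast at this ⊢
    rw [add_mul, ← add_assoc, one_mul, this]; ring
  | pred n ih =>
    have := sys.F_add_tau _ (hmem (-n - 1))
    rw [show u + ((-n - 1 : ℤ) : ℂ) * τ + τ = u + ((-n : ℤ) : ℂ) * τ by push_cast; ring, ih] at this
    push_cast at this ⊢
    linear_combination -this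

end QuasiEllipticSystem

/-- `f` agrees near `p`, away from `p`, with a function analytic at `p`. -/
def Removable (f : ℂ → ℂ) (p : ℂ) : Prop := ∃ g, AnalyticAt ℂ g p ∧ f =ᶠ[𝓝[≠] p] g

namespace Removable

variable {f g : ℂ → ℂ} {p : ℂ}

lemma of_analyticAt (h : AnalyticAt ℂ f p) : Removable f p := ⟨f, h, EventuallyEq.rfl⟩

lemma congr (hf : Removable f p) (h : g =ᶠ[𝓝[≠] p] f) : Removable g p :=
  let ⟨k, hk, hk'⟩ := hf; ⟨k, hk, h.trans hk'⟩

lemma mul (hf : Removable f p) (hg : Removable g p) : Removable (fun u => f u * g u) p :=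
  let ⟨k, hk, hk'⟩ := hf
  let ⟨l, hl, hl'⟩ := hg
  ⟨fun u => k u * l u, hk.fun_mul hl, hk'.mul hl'⟩

lemma add (hf : Removable f p) (hg : Removable g p) : Removable (fun u => f u + g u) p :=
  let ⟨k, hk, hk'⟩ := hf
  let ⟨l, hl, hl'⟩ := hg
  ⟨fun u => k u + l u, hk.fun_add hl, hk'.add hl'⟩

lemma pow (hf : Removable f p) (n : ℕ) : Removable (fun u => f u ^ n) p :=
  let ⟨k, hk, hk'⟩ := hf
  ⟨fun u => k u ^ n, hk.fun_pow n, hk'.pow_const n⟩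

lemma sum {ι : Type*} (s : Finset ι) {f : ι → ℂ → ℂ} (hf : ∀ i ∈ s, Removable (f i) p) :
    Removable (fun u => ∑ i ∈ s, f i u) p := by
  classical
  induction s using Finset.induction_on with
  | empty => simpa using of_analyticAt analyticAt_const
  | insert a s ha ih =>
    obtain ⟨k, hk, hk'⟩ := hf a (Finset.mem_insert_self a s)
    obtain ⟨l, hl, hl'⟩ := ih fun i hi => hf i (Finset.mem_insert_of_mem hi)
    refine ⟨fun u => k u + l u, hk.fun_add hl, ?_⟩
    simp only [Finset.sum_insert ha]
    exact hk'.add hl'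

lemma comp_add (a : ℂ) (hf : Removable f (p + a)) : Removable (fun u => f (u + a)) p := by
  obtain ⟨k, hk, hk'⟩ := hf
  refine ⟨fun u => k (u + a), AnalyticAt.comp_of_eq hk (by fun_prop) rfl, ?_⟩
  have ht : Tendsto (fun u : ℂ => u + a) (𝓝[≠] p) (𝓝[≠] (p + a)) :=
    tendsto_nhdsWithin_iff.mpr ⟨((continuous_id.add_const a).tendsto p).mono_left
      nhdsWithin_le_nhds, eventually_mem_nhdsWithin.mono fun u hu => by simpa using hu⟩
  exact ht.eventually hk'

/-- The extension of `f` across its removable singularities. -/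
noncomputable def extension (f : ℂ → ℂ) (u : ℂ) : ℂ := limUnder (𝓝[≠] u) f

lemma tendsto_extension (hf : Removable f p) : Tendsto f (𝓝[≠] p) (𝓝 (extension f p)) := by
  obtain ⟨k, hk, hk'⟩ := hf
  exact tendsto_nhds_limUnder
    ⟨k p, (hk.continuousAt.tendsto.mono_left nhdsWithin_le_nhds).congr' hk'.symm⟩

lemma extension_eq_of_tendsto {a : ℂ} (h : Tendsto f (𝓝[≠] p) (𝓝 a)) : extension f p = a :=
  h.limUnder_eq

lemma extension_eq (hf : ContinuousAt f p) : extension f p = f p :=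
  extension_eq_of_tendsto (hf.tendsto.mono_left nhdsWithin_le_nhds)

lemma analyticAt_extension (hf : Removable f p) : AnalyticAt ℂ (extension f) p := by
  obtain ⟨k, hk, hk'⟩ := hf
  refine hk.congr ?_
  have h1 : ∀ᶠ v in 𝓝 p, v ≠ p → f v = k v := eventually_nhdsWithin_iff.mp hk'
  filter_upwards [h1.eventually_nhds, hk.eventually_analyticAt] with v hv hkv
  symm
  apply extension_eq_of_tendsto
  refine (hkv.continuousAt.tendsto.mono_left nhdsWithin_le_nhds).congr' ?_
  by_cases hvp : v = p
  · subst hvp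
    exact (eventually_nhdsWithin_iff.mpr (hv.mono fun w hw hw' => (hw hw').symm))
  · have : ∀ᶠ w in 𝓝 v, w ≠ p := isOpen_ne.eventually_mem hvp
    exact nhdsWithin_le_nhds ((hv.and this).mono fun w hw => (hw.1 hw.2).symm)

end Removable

lemma norm_sin_le (w : ℂ) : ‖sin w‖ ≤ Real.exp |w.im| := by
  rw [Complex.sin, norm_div, norm_mul, norm_I, mul_one, Complex.norm_two, div_le_iff₀ two_pos]
  refine (norm_sub_le _ _).trans ?_
  rw [norm_exp, norm_exp, mul_two]
  gcongr
  · simpa using le_abs_self _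
  · simpa using neg_le_abs _

lemma sinh_abs_im_le_norm_sin (w : ℂ) : Real.sinh |w.im| ≤ ‖sin w‖ := by
  rw [Complex.sin, norm_div, norm_mul, norm_I, mul_one, Complex.norm_two, Real.sinh_eq]
  gcongr
  rcases le_total 0 w.im with h | h
  · have := norm_sub_norm_le (cexp (-w * I)) (cexp (w * I))
    rw [norm_exp, norm_exp] at this
    rw [abs_of_nonneg h]
    simpa using this
  · have := norm_sub_norm_le (cexp (w * I)) (cexp (-w * I))
    rw [norm_exp, norm_exp] at this
    rw [abs_of_nonpos h, norm_sub_rev]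
    simpa using this

lemma sinh_abs_im_le_norm_cos (w : ℂ) : Real.sinh |w.im| ≤ ‖cos w‖ := by
  have := sinh_abs_im_le_norm_sin (w + Real.pi / 2)
  rw [Complex.sin_add_pi_div_two] at this
  convert this using 3
  simp [show ((Real.pi : ℂ) / 2).im = 0 by rw [← ofReal_ofNat, ← ofReal_div, ofReal_im]]

lemma exp_mul_sinh_le (a b : ℝ) (ha : 0 ≤ a) :
    Real.exp a * Real.sinh b ≤ Real.sinh (a + b) := by
  rw [Real.sinh_add, ← Real.cosh_add_sinh]
  have h1 := (Real.sinh_lt_cosh b).le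
  have h2 : 0 ≤ Real.sinh a := Real.sinh_nonneg_iff.mpr ha
  nlinarith

/-- A periodic holomorphic function on a horizontal strip is bounded by its values on
the boundary lines. -/
lemma norm_le_of_periodic_strip {f : ℂ → ℂ} {R C : ℝ}
    (hf : ∀ u : ℂ, |u.im| ≤ R → AnalyticAt ℂ f u)
    (hper : ∀ u : ℂ, |u.im| ≤ R → ‖f (u + 1)‖ = ‖f u‖)
    (hC : ∀ u : ℂ, |u.im| = R → ‖f u‖ ≤ C) {u : ℂ} (hu : |u.im| < R) : ‖f u‖ ≤ C := by
  have hR : 0 < R := (abs_nonneg _).trans_lt hu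
  obtain ⟨B, hB⟩ : ∃ B, ∀ v : ℂ, |v.im| ≤ R → ‖f v‖ ≤ B := by
    have hK : IsCompact (Set.Icc (0 : ℝ) 1 ×ℂ Set.Icc (-R) R) :=
      (isCompact_Icc).reProdIm isCompact_Icc
    obtain ⟨B, hB⟩ := hK.exists_bound_of_continuousOn (f := f) fun v hv =>
      (hf v (abs_le.mpr hv.2)).continuousAt.continuousWithinAt
    refine ⟨B, fun v hv => ?_⟩
    have hint : ∀ (n : ℤ) (v : ℂ), |v.im| ≤ R → ‖f (v + n)‖ = ‖f v‖ := by
      intro n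
      induction n using Int.induction_on with
      | zero => simp
      | succ n ih =>
        intro v hv
        have := hper (v + ((n : ℤ) : ℂ)) (by simpa using hv)
        rw [← ih v hv, ← this]
        push_cast; ring_nf
      | pred n ih =>
        intro v hv
        rw [← ih v hv, ← hper (v + ((-(n : ℤ) - 1 : ℤ) : ℂ)) (by simpa using hv)]
        push_cast; ring_nf
    rw [← hint (-⌊v.re⌋) v hv]
    refine hB _ ⟨⟨?_, ?_⟩, ?_⟩
    · simpa using Int.floor_le v.re
    · have := (Int.lt_floor_add_one v.re).le
      simp; linarith
    · simpa [abs_le] using hv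
  refine PhragmenLindelof.horizontal_strip (f := f) (a := -R) (b := R) ?_ ?_ ?_ ?_
    (abs_lt.mp hu).1.le (abs_lt.mp hu).2.le
  · apply DifferentiableOn.diffContOnCl
    intro v hv
    have hcl : closure (Complex.im ⁻¹' Set.Ioo (-R) R) ⊆ Complex.im ⁻¹' Set.Icc (-R) R :=
      closure_minimal (Set.preimage_mono Set.Ioo_subset_Icc_self)
        (isClosed_Icc.preimage Complex.continuous_im)
    exact (hf v (abs_le.mpr (hcl hv))).differentiableAt.differentiableWithinAt
  · refine ⟨0, div_pos Real.pi_pos (by linarith), 0, ?_⟩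
    simp only [zero_mul, Real.exp_zero]
    refine Asymptotics.IsBigO.of_bound B ?_
    refine Filter.eventually_inf_principal.mpr (Eventually.of_forall fun v hv => ?_)
    simpa using hB v (abs_le.mpr ⟨hv.1.le, hv.2.le⟩)
  · intro v hv; exact hC v (by rw [hv, abs_neg, abs_of_pos hR])
  · intro v hv; exact hC v (by rw [hv, abs_of_pos hR])

lemma iteratedDeriv_eq_factorial_mul {f g : ℂ → ℂ} {a : ℂ} {n : ℕ} (hg : AnalyticAt ℂ g a)
    (h : ∀ᶠ u in 𝓝 a, f u = (u - a) ^ n * g u) : iteratedDeriv n f a = n.factorial * g a := by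
  induction n generalizing f g with
  | zero => simpa using h.self_of_nhds
  | succ n ih =>
    rw [iteratedDeriv_succ', ih (g := fun u => (n + 1) * g u + (u - a) * deriv g u)
      (by have := hg.deriv; fun_prop)]
    · simp [Nat.factorial_succ]; ring
    · filter_upwards [h.eventually_nhds, hg.eventually_analyticAt] with u hu hgu
      rw [EventuallyEq.deriv_eq hu]
      have := (((hasDerivAt_id u).sub_const a).fun_pow (n + 1)).fun_mul
        hgu.differentiableAt.hasDerivAt
      refine this.deriv.trans ?_
      simp only [id]
      push_cast
      ring

lemma analyticAt_dslope {f : ℂ → ℂ} {a : ℂ} (hf : AnalyticAt ℂ f a) :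
    AnalyticAt ℂ (dslope f a) a :=
  let ⟨_, hp⟩ := hf
  ⟨_, hp.has_fpower_series_dslope_fslope⟩

lemma eq_sub_mul_dslope {f : ℂ → ℂ} {a : ℂ} (hf : f a = 0) (u : ℂ) :
    f u = (u - a) * dslope f a u := by
  have := sub_smul_dslope f a u
  rw [hf, sub_zero, smul_eq_mul] at this
  exact this.symm

/-- The product of `sin (π (u - n τ))` over `|n| ≤ m`. -/
noncomputable def sinProd (τ : ℂ) (m : ℕ) (u : ℂ) : ℂ :=
  ∏ n ∈ Finset.Icc (-(m : ℤ)) m, sin (Real.pi * (u - n * τ))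

lemma analyticAt_sinProd (τ : ℂ) (m : ℕ) (u : ℂ) : AnalyticAt ℂ (sinProd τ m) u := by
  have : AnalyticAt ℂ (fun u => ∏ n ∈ Finset.Icc (-(m : ℤ)) m, sin (Real.pi * (u - n * τ))) u :=
    Finset.analyticAt_fun_prod _ fun n _ => by fun_prop
  exact this

lemma norm_sinProd_add_one (τ : ℂ) (m : ℕ) (u : ℂ) :
    ‖sinProd τ m (u + 1)‖ = ‖sinProd τ m u‖ := by
  simp only [sinProd, norm_prod]
  refine Finset.prod_congr rfl fun n _ => ?_
  rw [show (Real.pi : ℂ) * (u + 1 - n * τ) = Real.pi * (u - n * τ) + Real.pi by ring,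
    sin_add_pi, norm_neg]

lemma card_Icc_neg (m : ℕ) : (Finset.Icc (-(m : ℤ)) m).card = 2 * m + 1 := by
  simp; omega

lemma norm_sinProd_le {τ : ℂ} (hτ : 0 < τ.im) (m : ℕ) {u : ℂ} (hu : |u.im| ≤ (m + 1) * τ.im) :
    ‖sinProd τ m u‖ ≤ Real.exp (4 * Real.pi * τ.im) ^ ((m + 1) ^ 2) := by
  rw [sinProd, norm_prod]
  calc _ ≤ ∏ n ∈ Finset.Icc (-(m : ℤ)) m, Real.exp (2 * Real.pi * τ.im * (m + 1)) := by
        refine Finset.prod_le_prod (fun _ _ => norm_nonneg _) fun n hn => ?_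
        refine (norm_sin_le _).trans (Real.exp_le_exp.mpr ?_)
        have hn' : |(n : ℝ)| ≤ m := by
          rw [abs_le]; rw [Finset.mem_Icc] at hn
          exact ⟨by exact_mod_cast hn.1, by exact_mod_cast hn.2⟩
        have h1 : ((Real.pi : ℂ) * (u - n * τ)).im = Real.pi * (u.im - n * τ.im) := by
          simp
        have h2 : |(n : ℝ) * τ.im| ≤ m * τ.im := by
          rw [abs_mul, abs_of_pos hτ]; gcongr
        have h3 := abs_sub u.im (n * τ.im)
        rw [h1, abs_mul, abs_of_pos Real.pi_pos,
          show 2 * Real.pi * τ.im * (m + 1) = Real.pi * (2 * (m + 1) * τ.im) by ring]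
        gcongr
        linarith
    _ = Real.exp (2 * Real.pi * τ.im * (m + 1)) ^ (2 * m + 1) := by
        rw [Finset.prod_const, card_Icc_neg]
    _ ≤ _ := by
        rw [← Real.exp_nat_mul, ← Real.exp_nat_mul, Real.exp_le_exp]
        have : 0 ≤ Real.pi * τ.im * (m + 1) := by positivity
        push_cast
        nlinarith

lemma le_norm_sinProd_half {τ : ℂ} (hτ : 0 < τ.im) (m : ℕ) :
    min 1 (Real.sinh (Real.pi * τ.im)) ^ (2 * m + 1) ≤ ‖sinProd τ m (1 / 2)‖ := by
  have hs : 0 < Real.sinh (Real.pi * τ.im) := Real.sinh_pos_iff.mpr (by positivity)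
  rw [sinProd, norm_prod, ← card_Icc_neg m, ← Finset.prod_const]
  refine Finset.prod_le_prod (fun _ _ => (lt_min one_pos hs).le) fun n _ => ?_
  have h1 : sin (Real.pi * (1 / 2 - n * τ)) = cos (Real.pi * (n * τ)) := by
    rw [← Complex.sin_pi_div_two_sub]; ring_nf
  rw [h1]
  rcases eq_or_ne n 0 with rfl | hn
  · simp
  · refine (min_le_right _ _).trans (le_trans ?_ (sinh_abs_im_le_norm_cos _))
    rw [Real.sinh_le_sinh]
    have h2 : ((Real.pi : ℂ) * (n * τ)).im = Real.pi * (n * τ.im) := by simp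
    rw [h2, abs_mul, abs_mul, abs_of_pos Real.pi_pos, abs_of_pos hτ]
    have : (1 : ℝ) ≤ |(n : ℝ)| := by exact_mod_cast Int.one_le_abs hn
    gcongr
    nlinarith

lemma sinProd_eq_zero {τ : ℂ} {m : ℕ} {a b : ℤ} (hb : |b| ≤ m) :
    sinProd τ m (a + b * τ) = 0 := by
  refine Finset.prod_eq_zero (i := b) (Finset.mem_Icc.mpr (abs_le.mp hb)) ?_
  rw [add_sub_cancel_right, mul_comm]
  exact Complex.sin_int_mul_pi a

namespace QuasiEllipticSystem

variable {τ : ℂ} {hτ : 0 < τ.im} {F X Y : ℂ → ℂ} {c p q e κ : ℂ}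
  (sys : QuasiEllipticSystem τ hτ F X Y c p q e κ)

/-- The polynomial `∑ a i j F ^ i X ^ j` in `F` and `X`. -/
def auxiliary (F X : ℂ → ℂ) {L : ℕ} (a : Fin L × Fin L → ℂ) (u : ℂ) : ℂ :=
  ∑ x, a x * (F u ^ (x.1 : ℕ) * X u ^ (x.2 : ℕ))

include sys

lemma auxiliary_sub_int {L : ℕ} (a : Fin L × Fin L → ℂ) (u : ℂ) (n : ℤ) :
    auxiliary F X a (u - n) = auxiliary F X a u := by
  simp only [auxiliary, sys.X_sub_int, sys.F_sub_int]

lemma analyticAt_auxiliary {L : ℕ} (a : Fin L × Fin L → ℂ) {u : ℂ}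
    (hu : u ∉ (pair τ hτ).lattice) : AnalyticAt ℂ (auxiliary F X a) u := by
  have h1 := sys.analyticAt_F hu
  have h2 := sys.analyticAt_X hu
  have : AnalyticAt ℂ (fun u => ∑ x, a x * (F u ^ (x.1 : ℕ) * X u ^ (x.2 : ℕ))) u :=
    Finset.analyticAt_fun_sum _ fun x _ => by fun_prop
  exact this

lemma removable_F_mul_sinProd {a b : ℤ} {m : ℕ} (hb : |b| ≤ m) :
    Removable (fun u => F u * sinProd τ m u) (a + b * τ) := by
  obtain ⟨w, hw⟩ : ∃ w : ℂ, w = a + b * τ := ⟨_, rfl⟩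
  have hw0 : sinProd τ m w = 0 := hw ▸ sinProd_eq_zero hb
  rw [← hw]
  have h0 : Removable (fun u => u * F u) (w + -w) := by
    rw [add_neg_cancel]; exact sys.F_pole
  have hd := analyticAt_dslope (analyticAt_sinProd τ m w)
  refine Removable.congr (((h0.comp_add (-w)).mul (.of_analyticAt hd)).add
    (.of_analyticAt ((analyticAt_const (v := (b : ℂ) * κ)).fun_mul (analyticAt_sinProd τ m w)))) ?_
  have hl : ∀ᶠ u in 𝓝[≠] w, u - w ∉ (pair τ hτ).lattice := by
    have hwl : w ∈ (pair τ hτ).lattice := mem_pair_lattice.mpr ⟨a, b, hw.symm⟩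
    filter_upwards [nhdsWithin_le_nhds
      ((pair τ hτ).compl_lattice_sdiff_singleton_mem_nhds w), self_mem_nhdsWithin] with u hu hne hl
    exact hu ⟨by simpa using add_mem hl hwl, hne⟩
  filter_upwards [hl] with u hu
  have h1 : F u = F (u - w) + b * κ := by
    rw [← sys.F_add_int_mul_tau hu, ← sys.F_sub_int _ a]
    congr 1; linear_combination hw
  rw [h1, add_mul]
  nth_rewrite 1 [eq_sub_mul_dslope hw0 u]
  ring_nf

lemma removable_X_mul_sinProd {a b : ℤ} {m : ℕ} (hb : |b| ≤ m) :
    Removable (fun u => X u * sinProd τ m u ^ 2) (a + b * τ) := by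
  obtain ⟨w, hw⟩ : ∃ w : ℂ, w = a + b * τ := ⟨_, rfl⟩
  have hw0 : sinProd τ m w = 0 := hw ▸ sinProd_eq_zero hb
  rw [← hw]
  have h0 : Removable (fun u => u ^ 2 * X u) (w + -w) := by
    rw [add_neg_cancel]; exact sys.X_pole
  have hd := analyticAt_dslope (analyticAt_sinProd τ m w)
  refine Removable.congr ((h0.comp_add (-w)).mul ((Removable.of_analyticAt hd).pow 2)) ?_
  refine Eventually.of_forall fun u => ?_
  have h1 : X u = X (u - w) := by
    rw [← sys.X_add_int_mul_tau (u - w) b, ← sys.X_sub_int _ a]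
    congr 1; linear_combination hw
  simp only
  rw [h1, eq_sub_mul_dslope hw0 u]
  ring_nf

/-- The quotient whose maximum on a strip controls the derivatives of the auxiliary function. -/
noncomputable def quotient (τ : ℂ) (F X : ℂ → ℂ) {L : ℕ} (a : Fin L × Fin L → ℂ) (m t : ℕ)
    (u : ℂ) : ℂ :=
  auxiliary F X a u * sinProd τ m u ^ (3 * L) * (cos (Real.pi * u) ^ t)⁻¹

lemma norm_quotient_add_one {L : ℕ} (a : Fin L × Fin L → ℂ) (m t : ℕ) (u : ℂ) :
    ‖quotient τ F X a m t (u + 1)‖ = ‖quotient τ F X a m t u‖ := by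
  have h1 := sys.auxiliary_sub_int a (u + 1) 1
  rw [Int.cast_one, add_sub_cancel_right] at h1
  simp only [quotient, norm_mul, norm_pow, norm_inv, norm_sinProd_add_one, h1]
  rw [show (Real.pi : ℂ) * (u + 1) = Real.pi * u + Real.pi by ring, cos_add_pi, norm_neg]

lemma removable_quotient_of_mem {L : ℕ} (x : Fin L × Fin L → ℂ) (m t : ℕ) {a b : ℤ}
    (hb : |b| ≤ m) : Removable (quotient τ F X x m t) (a + b * τ) := by
  have hcos : cos (Real.pi * (a + b * τ)) ≠ 0 := by
    intro h
    obtain ⟨k, hk⟩ := Complex.cos_eq_zero_iff.mp h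
    have hpi : (Real.pi : ℂ) ≠ 0 := by exact_mod_cast Real.pi_ne_zero
    refine half_notMem_lattice hτ (mem_pair_lattice.mpr ⟨a - k, b, ?_⟩)
    apply mul_left_cancel₀ hpi
    push_cast
    linear_combination hk
  have hS := Removable.of_analyticAt (analyticAt_sinProd τ m (a + b * τ))
  have hF := sys.removable_F_mul_sinProd (a := a) hb
  have hX := sys.removable_X_mul_sinProd (a := a) hb
  refine Removable.congr ((Removable.sum Finset.univ fun y _ =>
    (((Removable.of_analyticAt analyticAt_const (f := fun _ => x y)).mul
      (hF.pow y.1)).mul (hX.pow y.2)).mul (hS.pow (3 * L - y.1 - 2 * y.2))).mul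
      (.of_analyticAt (f := fun u => (cos (Real.pi * u) ^ t)⁻¹)
        (AnalyticAt.fun_inv (by fun_prop) (pow_ne_zero _ hcos)))) ?_
  refine Eventually.of_forall fun u => ?_
  simp only [quotient, auxiliary, Finset.sum_mul]
  refine Finset.sum_congr rfl fun y _ => ?_
  have h1 := y.1.2
  have h2 := y.2.2
  rw [show 3 * L = y.1 + 2 * y.2 + (3 * L - y.1 - 2 * y.2) by omega, pow_add, pow_add, pow_mul,
    show (y.1 + 2 * y.2 + (3 * L - y.1 - 2 * y.2)) - y.1 - 2 * y.2 = 3 * L - y.1 - 2 * y.2 by omega]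
  ring

lemma analyticAt_quotient {L : ℕ} (x : Fin L × Fin L → ℂ) (m t : ℕ) {u : ℂ}
    (hu : u ∉ (pair τ hτ).lattice) (hc : cos (Real.pi * u) ≠ 0) :
    AnalyticAt ℂ (quotient τ F X x m t) u := by
  have h1 := sys.analyticAt_auxiliary x hu
  have h2 := analyticAt_sinProd τ m u
  have h3 : AnalyticAt ℂ (fun u => (cos (Real.pi * u) ^ t)⁻¹) u :=
    AnalyticAt.fun_inv (by fun_prop) (pow_ne_zero _ hc)
  exact (h1.fun_mul (h2.fun_pow _)).fun_mul h3

/-- Near a zero `1/2 + k` of the cosine the quotient extends, with value at the point determined by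
the first nonvanishing derivative of the auxiliary function. -/
lemma quotient_near_half {L : ℕ} (x : Fin L × Fin L → ℂ) (m t : ℕ)
    (h0 : ∀ k < t, iteratedDeriv k (auxiliary F X x) (1 / 2) = 0) (k : ℤ) :
    ∃ g : ℂ → ℂ, AnalyticAt ℂ g (1 / 2 + k) ∧ quotient τ F X x m t =ᶠ[𝓝[≠] (1 / 2 + k : ℂ)] g ∧
      (k = 0 → ‖g (1 / 2 + k)‖ = ‖iteratedDeriv t (auxiliary F X x) (1 / 2)‖ / t.factorial *
        ‖sinProd τ m (1 / 2)‖ ^ (3 * L) / Real.pi ^ t) := by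
  have hA := sys.analyticAt_auxiliary x (half_notMem_lattice hτ)
  obtain ⟨φ, hφ, hφ'⟩ := (natCast_le_analyticOrderAt hA).mp
    ((natCast_le_analyticOrderAt_iff_iteratedDeriv_eq_zero hA).mpr h0)
  have hφt := iteratedDeriv_eq_factorial_mul hφ hφ'
  set w : ℂ := 1 / 2 + k
  have hw : cos (Real.pi * w) = 0 := Complex.cos_eq_zero_iff.mpr ⟨k, by simp only [w]; ring⟩
  set γ := dslope (fun u : ℂ => cos (Real.pi * u)) w with hγ
  have hγa : AnalyticAt ℂ γ w := analyticAt_dslope (by fun_prop)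
  have hγw : ‖γ w‖ = Real.pi := by
    have : HasDerivAt (fun u : ℂ => cos (Real.pi * u)) (-sin (Real.pi * w) * (Real.pi * 1)) w :=
      (Complex.hasDerivAt_cos _).comp w ((hasDerivAt_id w).const_mul _)
    rw [hγ, dslope_same, this.deriv]
    have h1 : ‖sin (Real.pi * w)‖ = 1 := by
      have := Complex.sin_sq_add_cos_sq (Real.pi * w)
      rw [hw, zero_pow two_ne_zero, add_zero] at this
      have h2 := congrArg norm this
      rw [norm_pow, norm_one] at h2
      exact (pow_eq_one_iff_of_nonneg (norm_nonneg _) two_ne_zero).mp h2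
    rw [norm_mul, norm_neg, h1]
    simp [abs_of_pos Real.pi_pos]
  have hγ0 : γ w ≠ 0 := by rw [← norm_pos_iff, hγw]; exact Real.pi_pos
  have hsub : AnalyticAt ℂ (fun u => φ (u - k)) w :=
    AnalyticAt.comp_of_eq (f := fun u : ℂ => u - k) hφ (by fun_prop) (by simp [w])
  refine ⟨fun u => φ (u - k) * sinProd τ m u ^ (3 * L) * (γ u ^ t)⁻¹,
    (hsub.fun_mul ((analyticAt_sinProd τ m w).fun_pow _)).fun_mul
      ((hγa.fun_pow t).fun_inv (pow_ne_zero _ hγ0)), ?_, ?_⟩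
  · have ht : Tendsto (fun u : ℂ => u - k) (𝓝 w) (𝓝 (1 / 2)) := by
      have : Continuous (fun u : ℂ => u - k) := by fun_prop
      convert this.tendsto w using 2; simp [w]
    filter_upwards [nhdsWithin_le_nhds (ht.eventually hφ'), self_mem_nhdsWithin] with u hu hne
    have hne' : u - w ≠ 0 := sub_ne_zero.mpr hne
    have e1 : u - k - 1 / 2 = u - w := by simp only [w]; ring
    rw [quotient, ← sys.auxiliary_sub_int x u k, hu, e1,
      eq_sub_mul_dslope (f := fun u : ℂ => cos (Real.pi * u)) hw u, mul_pow, smul_eq_mul, ← hγ]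
    field_simp
  · intro hk
    have e1 : w = 1 / 2 := by simp [w, hk]
    have e2 : w - k = 1 / 2 := by simp [w]
    simp only [e2]
    rw [norm_mul, norm_mul, norm_pow, norm_inv, norm_pow, hγw, hφt, e1, norm_mul, norm_natCast]
    have : (t.factorial : ℝ) ≠ 0 := by positivity
    field_simp

lemma exists_bound_on_line : ∃ B : ℝ, 1 ≤ B ∧ ‖κ‖ ≤ B ∧
    ∀ u : ℂ, u.im = τ.im / 2 → ‖F u‖ ≤ B ∧ ‖X u‖ ≤ B := by
  have hmem : ∀ u : ℂ, u.im = τ.im / 2 → u ∉ (pair τ hτ).lattice := by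
    rintro u hu h
    obtain ⟨a, b, rfl⟩ := mem_pair_lattice.mp h
    simp at hu
    have h2 : (b : ℝ) = 1 / 2 := by
      apply mul_right_cancel₀ hτ.ne'; linarith
    have h3 : (2 * b : ℝ) = 1 := by linarith
    have h4 : 2 * b = 1 := by exact_mod_cast h3
    omega
  have hK : IsCompact (Set.Icc (0 : ℝ) 1 ×ℂ {τ.im / 2}) :=
    isCompact_Icc.reProdIm isCompact_singleton
  obtain ⟨B₁, hB₁⟩ := hK.exists_bound_of_continuousOn (f := F) fun v hv =>
    (sys.analyticAt_F (hmem v hv.2)).continuousAt.continuousWithinAt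
  obtain ⟨B₂, hB₂⟩ := hK.exists_bound_of_continuousOn (f := X) fun v hv =>
    (sys.analyticAt_X (hmem v hv.2)).continuousAt.continuousWithinAt
  refine ⟨max (max 1 ‖κ‖) (max B₁ B₂), by simp, by simp, fun u hu => ?_⟩
  have hK' : u - (⌊u.re⌋ : ℤ) ∈ Set.Icc (0 : ℝ) 1 ×ℂ {τ.im / 2} := by
    refine ⟨⟨?_, ?_⟩, ?_⟩
    · simp
    · simpa using (Int.fract_lt_one u.re).le
    · simpa using hu
  rw [← sys.F_sub_int u ⌊u.re⌋, ← sys.X_sub_int u ⌊u.re⌋]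
  exact ⟨(hB₁ _ hK').trans (by simp), (hB₂ _ hK').trans (by simp)⟩

lemma norm_auxiliary_le {B A : ℝ} (hB : 1 ≤ B) (hκ : ‖κ‖ ≤ B)
    (hline : ∀ u : ℂ, u.im = τ.im / 2 → ‖F u‖ ≤ B ∧ ‖X u‖ ≤ B) {L m : ℕ}
    {a : Fin L × Fin L → ℂ} (hA : 0 ≤ A) (ha : ∀ x, ‖a x‖ ≤ A) {u : ℂ}
    (hul : u ∉ (pair τ hτ).lattice)
    (hu : |u.im| = (m + 1 / 2) * τ.im) :
    ‖auxiliary F X a u‖ ≤ A * (8 * B ^ 2) ^ (L * (m + 1) ^ 2) := by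
  obtain ⟨k, hk, hku⟩ : ∃ k : ℤ, |(k : ℝ)| ≤ m + 1 ∧ (u - k * τ).im = τ.im / 2 := by
    rcases abs_choice u.im with h | h <;> rw [h] at hu
    · refine ⟨m, ?_, ?_⟩
      · simp
      · simp [hu]; ring
    · refine ⟨-(m + 1), ?_, ?_⟩
      · rw [abs_le]; push_cast; constructor <;> linarith [(Nat.cast_nonneg m : (0 : ℝ) ≤ m)]
      · simp; linarith
  have hv : u - k * τ ∉ (pair τ hτ).lattice := fun h => hul <| by
    obtain ⟨x, y, h⟩ := mem_pair_lattice.mp h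
    exact mem_pair_lattice.mpr ⟨x, y + k, by push_cast; linear_combination h⟩
  have hF := sys.F_add_int_mul_tau hv k
  have hX := sys.X_add_int_mul_tau (u - k * τ) k
  rw [sub_add_cancel] at hF hX
  have hm : (1 : ℝ) ≤ m + 1 := by linarith [(Nat.cast_nonneg m : (0 : ℝ) ≤ m)]
  have hFb : ‖F u‖ ≤ 2 * B * (m + 1) := by
    rw [hF]
    calc _ ≤ ‖F (u - k * τ)‖ + ‖(k : ℂ) * κ‖ := norm_add_le _ _
      _ ≤ B + (m + 1) * B := by
        rw [norm_mul, Complex.norm_intCast]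
        gcongr
        exact (hline _ hku).1
      _ ≤ _ := by nlinarith
  have hXb : ‖X u‖ ≤ B := hX ▸ (hline _ hku).2
  have hB1 : 1 ≤ 2 * B * (m + 1) := by nlinarith
  calc ‖auxiliary F X a u‖ ≤ ∑ _x : Fin L × Fin L, A * ((2 * B * (m + 1)) ^ L * B ^ L) := by
        refine norm_sum_le_of_le _ fun x _ => ?_
        rw [norm_mul, norm_mul, norm_pow, norm_pow]
        gcongr
        · exact ha x
        · exact (pow_le_pow_left₀ (norm_nonneg _) hFb _).trans
            (pow_le_pow_right₀ hB1 x.1.2.le)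
        · exact (pow_le_pow_left₀ (norm_nonneg _) hXb _).trans (pow_le_pow_right₀ hB x.2.2.le)
    _ = A * ((L : ℝ) ^ 2 * (2 * B ^ 2) ^ L * (m + 1) ^ L) := by
        simp only [Finset.sum_const, Finset.card_univ, Fintype.card_prod, Fintype.card_fin,
          nsmul_eq_mul, mul_pow]
        push_cast; ring
    _ ≤ A * ((2 ^ L) ^ 2 * (2 * B ^ 2) ^ L * (2 ^ m) ^ L) := by
        gcongr
        · exact_mod_cast L.lt_two_pow_self.le
        · exact_mod_cast Nat.lt_two_pow_self
    _ = A * ((8 * B ^ 2) ^ L * 2 ^ (m * L)) := by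
        have h8 : (8 * B ^ 2) ^ L = (2 ^ L) ^ 2 * (2 * B ^ 2) ^ L := by
          rw [← pow_mul, mul_comm L 2, pow_mul, ← mul_pow]
          congr 1; ring
        rw [h8, pow_mul]
    _ ≤ A * ((8 * B ^ 2) ^ L * (8 * B ^ 2) ^ (m * L)) := by
        gcongr; nlinarith
    _ ≤ A * (8 * B ^ 2) ^ (L * (m + 1) ^ 2) := by
        rw [← pow_add]
        gcongr
        · nlinarith
        · nlinarith [Nat.zero_le (L * m)]

/-- Schwarz-type estimate for the first nonvanishing derivative of the auxiliary function. -/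
lemma exists_norm_iteratedDeriv_le : ∃ C c₁ : ℝ, 1 ≤ C ∧ 0 < c₁ ∧
    ∀ (L t m : ℕ) (a : Fin L × Fin L → ℂ) (A : ℝ), 0 ≤ A → (∀ x, ‖a x‖ ≤ A) →
      (∀ k < t, iteratedDeriv k (auxiliary F X a) (1 / 2) = 0) →
      ‖iteratedDeriv t (auxiliary F X a) (1 / 2)‖ ≤
        A * t.factorial * C ^ t * C ^ (L * (m + 1) ^ 2) * Real.exp (-(c₁ * m * t)) := by
  obtain ⟨B, hB, hκ, hline⟩ := sys.exists_bound_on_line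
  have hπ := Real.pi_pos
  set s : ℝ := Real.sinh (Real.pi * (τ.im / 2)) with hs
  have hs0 : 0 < s := Real.sinh_pos_iff.mpr (by positivity)
  set c₀ : ℝ := min 1 (Real.sinh (Real.pi * τ.im)) with hc₀
  have hc₀0 : 0 < c₀ := lt_min one_pos (Real.sinh_pos_iff.mpr (by positivity))
  have hc₀1 : c₀ ≤ 1 := min_le_left _ _
  set E : ℝ := Real.exp (4 * Real.pi * τ.im) with hE
  set C₁ : ℝ := 8 * B ^ 2 * E ^ 3 * (c₀⁻¹) ^ 6 with hC₁
  refine ⟨max (max 1 (Real.pi / s)) C₁, Real.pi * τ.im, by simp, by positivity,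
    fun L t m a A hA ha h0 => ?_⟩
  have hmain : ‖iteratedDeriv t (auxiliary F X a) (1 / 2)‖ / t.factorial *
        ‖sinProd τ m (1 / 2)‖ ^ (3 * L) / Real.pi ^ t ≤
      A * (8 * B ^ 2) ^ (L * (m + 1) ^ 2) * (E ^ ((m + 1) ^ 2)) ^ (3 * L) *
        ((Real.exp (Real.pi * τ.im * m) * s) ^ t)⁻¹ := by
    set R : ℝ := (m + 1 / 2) * τ.im with hR
    have hR0 : 0 < R := by positivity
    have hRm : R < (m + 1) * τ.im := by rw [hR]; gcongr; norm_num
    have hrem : ∀ u : ℂ, |u.im| ≤ R → Removable (quotient τ F X a m t) u := by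
      intro u hu
      by_cases hul : u ∈ (pair τ hτ).lattice
      · obtain ⟨x, y, rfl⟩ := mem_pair_lattice.mp hul
        refine sys.removable_quotient_of_mem a m t ?_
        have h1 : |(y : ℝ)| * τ.im < (m + 1) * τ.im := by
          have := hu.trans_lt hRm
          simpa [abs_mul, abs_of_pos hτ] using this
        have h2 : |(y : ℝ)| < m + 1 := lt_of_mul_lt_mul_right h1 hτ.le
        have h3 : |y| < m + 1 := by exact_mod_cast h2
        omega
      · by_cases hc : cos (Real.pi * u) = 0
        · obtain ⟨k, hk⟩ := Complex.cos_eq_zero_iff.mp hc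
          have hpi : (Real.pi : ℂ) ≠ 0 := by exact_mod_cast Real.pi_ne_zero
          have hu' : u = 1 / 2 + k := by
            apply mul_left_cancel₀ hpi; rw [hk]; ring
          obtain ⟨g, hg, hg', -⟩ := sys.quotient_near_half a m t h0 k
          exact hu' ▸ ⟨g, hg, hg'⟩
        · exact .of_analyticAt (sys.analyticAt_quotient a m t hul hc)
    obtain ⟨g, hg, hg', hg0⟩ := sys.quotient_near_half a m t h0 0
    rw [Int.cast_zero, add_zero] at hg hg' hg0
    have hval : Removable.extension (quotient τ F X a m t) (1 / 2) = g (1 / 2) :=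
      Removable.extension_eq_of_tendsto
        ((hg.continuousAt.tendsto.mono_left nhdsWithin_le_nhds).congr' hg'.symm)
    rw [← hg0 rfl, ← hval]
    refine norm_le_of_periodic_strip (R := R) (fun u hu => (hrem u hu).analyticAt_extension)
      (fun u hu => ?_) (fun u hu => ?_) (by simpa using hR0)
    · have h1 := (hrem u hu).tendsto_extension.norm
      have ht : Tendsto (fun v : ℂ => v + 1) (𝓝[≠] u) (𝓝[≠] (u + 1)) :=
        tendsto_nhdsWithin_iff.mpr ⟨((continuous_id.add_const 1).tendsto u).mono_left
          nhdsWithin_le_nhds, eventually_mem_nhdsWithin.mono fun v hv => by simpa using hv⟩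
      have h2 := ((hrem (u + 1) (by simpa using hu)).tendsto_extension.comp ht).norm
      simp only [Function.comp_apply, sys.norm_quotient_add_one] at h2
      exact tendsto_nhds_unique h2 h1
    · have hul : u ∉ (pair τ hτ).lattice := by
        intro hul
        obtain ⟨x, y, rfl⟩ := mem_pair_lattice.mp hul
        have h1 : |(y : ℝ)| * τ.im = (m + 1 / 2) * τ.im := by
          simpa [abs_mul, abs_of_pos hτ, hR] using hu
        have h2 : 2 * |(y : ℝ)| = 2 * m + 1 := by
          rw [mul_right_cancel₀ hτ.ne' h1]; ring
        have h3 : 2 * |y| = 2 * m + 1 := by exact_mod_cast h2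
        omega
      have hcl : Real.exp (Real.pi * τ.im * m) * s ≤ ‖cos (Real.pi * u)‖ := by
        refine (exp_mul_sinh_le _ _ (by positivity)).trans
          (le_trans (le_of_eq ?_) (sinh_abs_im_le_norm_cos _))
        have : ((Real.pi : ℂ) * u).im = Real.pi * u.im := by simp
        rw [this, abs_mul, abs_of_pos hπ, hu, hR]
        ring_nf
      have hc0 : 0 < ‖cos (Real.pi * u)‖ := lt_of_lt_of_le (by positivity) hcl
      rw [Removable.extension_eq
        (sys.analyticAt_quotient a m t hul (norm_pos_iff.mp hc0)).continuousAt, quotient,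
        norm_mul, norm_mul, norm_inv, norm_pow, norm_pow]
      have hS := norm_sinProd_le hτ m (u := u) (by rw [hu]; exact hRm.le)
      have hX := sys.norm_auxiliary_le hB hκ hline hA ha hul (m := m) hu
      gcongr
  have hS := le_norm_sinProd_half hτ m
  have hS0 : c₀ ^ (6 * (L * (m + 1) ^ 2)) ≤ ‖sinProd τ m (1 / 2)‖ ^ (3 * L) := by
    refine le_trans ?_ (pow_le_pow_left₀ (by positivity) hS _)
    rw [← pow_mul]
    refine pow_le_pow_of_le_one hc₀0.le hc₀1 ?_
    nlinarith [Nat.zero_le (L * m), Nat.zero_le (L * m ^ 2)]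
  set D := ‖iteratedDeriv t (auxiliary F X a) (1 / 2)‖
  have hD : D ≤ A * t.factorial * (Real.pi / s) ^ t * C₁ ^ (L * (m + 1) ^ 2) *
      Real.exp (-(Real.pi * τ.im * m * t)) := by
    have h1 : D / t.factorial * c₀ ^ (6 * (L * (m + 1) ^ 2)) / Real.pi ^ t ≤ _ :=
      le_trans (by gcongr) hmain
    have hexp : Real.exp (-(Real.pi * τ.im * m * t)) = (Real.exp (Real.pi * τ.im * m) ^ t)⁻¹ := by
      rw [Real.exp_neg, ← Real.exp_nat_mul]; ring_nf
    rw [hexp]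
    have h2 : 0 < (t.factorial : ℝ) := by positivity
    rw [div_mul_eq_mul_div, div_div, div_le_iff₀ (by positivity)] at h1
    have h3 : 0 < c₀ ^ (6 * (L * (m + 1) ^ 2)) := by positivity
    rw [← le_div_iff₀ h3] at h1
    refine h1.trans (le_of_eq ?_)
    rw [hC₁, ← pow_mul E, show (m + 1) ^ 2 * (3 * L) = 3 * (L * (m + 1) ^ 2) by ring,
      pow_mul E 3, mul_pow _ (c₀⁻¹ ^ 6), mul_pow _ (E ^ 3), ← pow_mul c₀⁻¹, inv_pow, mul_pow _ s,
      div_pow]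
    field_simp
  refine hD.trans ?_
  have h5 : 0 ≤ C₁ := by positivity
  gcongr
  · exact (le_max_right _ _).trans (le_max_left _ _)
  · exact le_max_right _ _

end QuasiEllipticSystem

section NumberField
open NumberField Module

variable (K : Type*) [Field K] [NumberField K]

lemma house_le {K : Type*} [Field K] [NumberField K] {x : K} {B : ℝ}
    (h : ∀ φ : K →+* ℂ, ‖φ x‖ ≤ B) :
    house x ≤ B := by
  have hB : 0 ≤ B := (norm_nonneg _).trans (h (Classical.arbitrary _))
  rw [house]
  exact (pi_norm_le_iff_of_nonneg hB).mpr h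

/-- Siegel's lemma for `2 n²` equations in `4 n²` unknowns. -/
lemma exists_siegel : ∃ C : ℝ, 1 ≤ C ∧ ∀ n : ℕ, 0 < n →
    ∀ a : Matrix (Fin (2 * n ^ 2)) (Fin (2 * n) × Fin (2 * n)) (𝓞 K), a ≠ 0 →
    ∀ A : ℝ, (∀ k l, house (a k l : K) ≤ A) →
    ∃ ξ : Fin (2 * n) × Fin (2 * n) → 𝓞 K, ξ ≠ 0 ∧ Matrix.mulVec a ξ = 0 ∧
      ∀ l, house (ξ l : K) ≤ C * n ^ 2 * A := by
  classical
  obtain ⟨c, hc⟩ : ∃ c : ℝ, ∀ (p q : ℕ) (α β : Type) [Fintype α] [Fintype β]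
      (a : Matrix α β (𝓞 K)) (A : ℝ), a ≠ 0 → 0 < p → p < q → Fintype.card α = p →
      Fintype.card β = q → (∀ k l, house (a k l : K) ≤ A) →
      ∃ ξ : β → 𝓞 K, ξ ≠ 0 ∧ Matrix.mulVec a ξ = 0 ∧
        ∀ l, house (ξ l : K) ≤ c * ((c * (q : ℝ) * A) ^ ((p : ℝ) / (q - p))) :=
    ⟨_, fun p q α β _ _ a A ha h0 h1 h2 h3 h =>
      house.exists_ne_zero_int_vec_house_le K a ha h0 h1 h3 h h2⟩
  refine ⟨max 1 (4 * c ^ 2), le_max_left _ _, fun n hn a ha A h => ?_⟩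
  obtain ⟨ξ, h1, h2, h3⟩ := hc (2 * n ^ 2) (4 * n ^ 2) _ _ a A ha (by positivity)
    (by nlinarith [pow_pos hn 2]) (Fintype.card_fin _)
    (by simp only [Fintype.card_prod, Fintype.card_fin]; ring) h
  refine ⟨ξ, h1, h2, fun l => (h3 l).trans ?_⟩
  have hn' : (n : ℝ) ≠ 0 := by positivity
  have he : (((2 * n ^ 2 : ℕ) : ℝ) / (((4 * n ^ 2 : ℕ) : ℝ) - ((2 * n ^ 2 : ℕ) : ℝ))) = 1 := by
    rw [div_eq_one_iff_eq]
    · push_cast; ring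
    · push_cast; ring_nf; positivity
  rw [he, Real.rpow_one]
  calc c * (c * ((4 * n ^ 2 : ℕ) : ℝ) * A) = (4 * c ^ 2) * n ^ 2 * A := by push_cast; ring
    _ ≤ _ := by
        have hA : 0 ≤ A := (NumberField.house_nonneg _).trans
          (h ⟨0, by positivity⟩ (⟨0, by omega⟩, ⟨0, by omega⟩))
        gcongr; exact le_max_right _ _

lemma one_le_norm_mul_pow {K : Type*} [Field K] [NumberField K] {x : 𝓞 K} (hx : x ≠ 0) {B : ℝ}
    (h : ∀ φ : K →+* ℂ, ‖φ x‖ ≤ B) (σ : K →+* ℂ) : 1 ≤ ‖σ x‖ * B ^ (finrank ℚ K - 1) := by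
  have h1 : (1 : ℝ) ≤ ‖Algebra.norm ℚ (x : K)‖ := by
    have h2 : Algebra.norm ℤ x ≠ 0 := Algebra.norm_ne_zero_iff.mpr hx
    have h3 : (Algebra.norm ℚ (x : K)) = ((Algebra.norm ℤ x : ℤ) : ℚ) := by
      exact (Algebra.coe_norm_int x).symm
    rw [h3, ← Rat.norm_cast_real]
    simp only [Rat.cast_intCast, Real.norm_eq_abs]
    exact_mod_cast Int.one_le_abs h2
  refine h1.trans ((norm_norm_le_norm_mul_house_pow (x : K) σ).trans ?_)
  gcongr
  · exact house_nonneg _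
  · exact house_le h

/-- Three complex algebraic integers are simultaneously realized in a number field. -/
lemma exists_numberField {p q e : ℂ} (hp : IsIntegral ℤ p) (hq : IsIntegral ℤ q)
    (he : IsIntegral ℤ e) : ∃ (K : Type) (_ : Field K) (_ : NumberField K) (σ : K →+* ℂ)
      (p' q' e' : 𝓞 K), σ p' = p ∧ σ q' = q ∧ σ e' = e := by
  have hQ : ∀ {x : ℂ}, IsIntegral ℤ x → IsIntegral ℚ x := fun h => h.tower_top
  let E := IntermediateField.adjoin ℚ ({p, q, e} : Set ℂ)
  have hfd : FiniteDimensional ℚ E := IntermediateField.finiteDimensional_adjoin <| by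
    rintro x (rfl | rfl | rfl)
    exacts [hQ hp, hQ hq, hQ he]
  have hnf : NumberField E := { to_charZero := inferInstance, to_finiteDimensional := hfd }
  have hint : ∀ x : E, IsIntegral ℤ (x : ℂ) → IsIntegral ℤ x := fun x hx =>
    (isIntegral_algHom_iff (E.val.restrictScalars ℤ) E.val.injective).mp hx
  have hm : ∀ x ∈ ({p, q, e} : Set ℂ), x ∈ E := fun x hx =>
    IntermediateField.subset_adjoin ℚ _ hx
  refine ⟨E, inferInstance, hnf, E.val.toRingHom, ⟨⟨p, hm p (by simp)⟩, hint _ hp⟩,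
    ⟨⟨q, hm q (by simp)⟩, hint _ hq⟩, ⟨⟨e, hm e (by simp)⟩, hint _ he⟩, rfl, rfl, rfl⟩

end NumberField

lemma eq_zero_of_infinite_zeros {L : ℕ} {b : Fin L → ℂ} {s : Set ℂ} (hs : s.Infinite)
    (h : ∀ y ∈ s, ∑ i, b i * y ^ (i : ℕ) = 0) : b = 0 := by
  set P : Polynomial ℂ := ∑ i : Fin L, Polynomial.C (b i) * Polynomial.X ^ (i : ℕ) with hP
  have h0 : P = 0 := Polynomial.eq_zero_of_infinite_isRoot P <| hs.mono fun y hy => by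
    simpa [hP, Polynomial.IsRoot, Polynomial.eval_finsetSum] using h y hy
  funext i
  have := congrArg (fun Q => Polynomial.coeff Q i) h0
  simpa [hP, Polynomial.coeff_X_pow, ← Fin.ext_iff] using this

namespace QuasiEllipticSystem

variable {τ : ℂ} {hτ : 0 < τ.im} {F X Y : ℂ → ℂ} {c p q e κ : ℂ}
  (sys : QuasiEllipticSystem τ hτ F X Y c p q e κ)
include sys

lemma auxiliary_ne_zero {L : ℕ} {a : Fin L × Fin L → ℂ} (ha : a ≠ 0) :
    ∃ u ∉ (pair τ hτ).lattice, auxiliary F X a u ≠ 0 := by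
  by_contra! h
  apply ha
  have h1 : ∀ u ∉ (pair τ hτ).lattice, ∀ i, ∑ j, a (i, j) * X u ^ (j : ℕ) = 0 := by
    intro u hu
    have h2 : (fun i => ∑ j, a (i, j) * X u ^ (j : ℕ)) = 0 := by
      refine eq_zero_of_infinite_zeros (s := Set.range fun n : ℤ => F u + n * κ)
        (Set.infinite_range_of_injective fun m n hmn => ?_) ?_
      · simpa [sys.κ_ne] using hmn
      · rintro _ ⟨n, rfl⟩
        have hn : u + n * τ ∉ (pair τ hτ).lattice := fun hn => hu <| by
          obtain ⟨x, y, h⟩ := mem_pair_lattice.mp hn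
          exact mem_pair_lattice.mpr ⟨x, y - n, by push_cast; linear_combination h⟩
        have := h _ hn
        rw [auxiliary, sys.F_add_int_mul_tau hu, sys.X_add_int_mul_tau, Fintype.sum_prod_type]
          at this
        rw [← this]
        refine Finset.sum_congr rfl fun i _ => ?_
        rw [Finset.sum_mul]
        exact Finset.sum_congr rfl fun j _ => by ring
    exact congrFun h2
  have h3 : (X '' ((pair τ hτ).lattice : Set ℂ)ᶜ).Infinite := by
    intro hfin
    have hb : ∀ᶠ u in 𝓝[≠] (0 : ℂ), X u ∉ X '' ((pair τ hτ).lattice : Set ℂ)ᶜ :=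
      sys.X_tendsto.eventually (Bornology.isBounded_def.mp hfin.isBounded)
    have hl : ∀ᶠ u in 𝓝[≠] (0 : ℂ), u ∉ (pair τ hτ).lattice := by
      filter_upwards [nhdsWithin_le_nhds
        ((pair τ hτ).compl_lattice_sdiff_singleton_mem_nhds 0),
        self_mem_nhdsWithin] with u hu hne hl
      exact hu ⟨hl, hne⟩
    obtain ⟨u, hu1, hu2⟩ := (hb.and hl).exists
    exact hu1 ⟨u, hu2, rfl⟩
  funext ⟨i, j⟩
  refine congrFun (eq_zero_of_infinite_zeros (b := fun j => a (i, j)) h3 ?_) j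
  rintro _ ⟨u, hu, rfl⟩
  exact h1 u hu i

lemma exists_first_nonvanishing {L : ℕ} {a : Fin L × Fin L → ℂ} (ha : a ≠ 0) :
    ∃ t, iteratedDeriv t (auxiliary F X a) (1 / 2) ≠ 0 ∧
      ∀ k < t, iteratedDeriv k (auxiliary F X a) (1 / 2) = 0 := by
  classical
  have hex : ∃ t, iteratedDeriv t (auxiliary F X a) (1 / 2) ≠ 0 := by
    by_contra! h
    have hA := sys.analyticAt_auxiliary a (half_notMem_lattice hτ)
    have htop : analyticOrderAt (auxiliary F X a) (1 / 2) = ⊤ :=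
      ENat.eq_top_iff_forall_ge.mpr fun n =>
        (natCast_le_analyticOrderAt_iff_iteratedDeriv_eq_zero hA).mpr fun i _ => h i
    obtain ⟨u, hu, hu'⟩ := sys.auxiliary_ne_zero ha
    refine hu' (AnalyticOnNhd.eqOn_zero_of_preconnected_of_eventuallyEq_zero
      (fun v hv => sys.analyticAt_auxiliary a hv) (isPreconnected_compl_lattice (pair τ hτ))
      (half_notMem_lattice hτ) (analyticOrderAt_eq_top.mp htop) hu)
  exact ⟨Nat.find hex, Nat.find_spec hex, fun k hk => not_not.mp (Nat.find_min hex hk)⟩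

lemma pow_mul_iteratedDeriv_auxiliary {L : ℕ} (a : Fin L × Fin L → ℂ) (k : ℕ) :
    c ^ k * iteratedDeriv k (auxiliary F X a) (1 / 2) =
      ∑ x, a x * jet p q e k x.1 x.2 0 := by
  have h1 : auxiliary F X a =
      fun u => ∑ x, a x * (F u ^ (x.1 : ℕ) * X u ^ (x.2 : ℕ) * Y u ^ 0) := by
    funext u; simp [auxiliary]
  rw [h1, iteratedDeriv_fun_sum fun x _ =>
    contDiffAt_const.mul (sys.contDiffAt_monomial k x.1 x.2 0), Finset.mul_sum]
  refine Finset.sum_congr rfl fun x _ => ?_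
  rw [iteratedDeriv_const_mul_field, ← sys.iteratedDeriv_monomial]
  ring

end QuasiEllipticSystem

lemma exists_fourth_root {t : ℕ} (ht : 0 < t) : ∃ m : ℕ, (m + 1) ^ 4 ≤ t ∧ t < (m + 2) ^ 4 := by
  classical
  have hex : ∃ m : ℕ, t < (m + 2) ^ 4 :=
    ⟨t, (by omega : t < t + 2).trans_le (Nat.le_self_pow (by norm_num) _)⟩
  refine ⟨Nat.find hex, ?_, Nat.find_spec hex⟩
  rcases h : Nat.find hex with _ | m
  · simpa using Nat.succ_le_of_lt ht
  · have := Nat.find_min hex (m := m) (by omega)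
    exact not_lt.mp this

lemma eventually_mul_pow_mul_exp_lt_one (A : ℝ) {b : ℝ} (hb : 0 < b) (k : ℕ) :
    ∀ᶠ m : ℕ in atTop, A * ((m : ℝ) + 2) ^ k * Real.exp (-(b * m)) < 1 := by
  have h1 := Real.tendsto_pow_mul_exp_neg_atTop_nhds_zero k
  have h2 : Tendsto (fun m : ℕ => b * ((m : ℝ) + 2)) atTop atTop :=
    (tendsto_atTop_add_const_right _ 2 tendsto_natCast_atTop_atTop).const_mul_atTop hb
  have h3 := (h1.comp h2).const_mul (A / b ^ k * Real.exp (2 * b))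
  rw [mul_zero] at h3
  filter_upwards [h3.eventually_lt_const one_pos] with m hm
  refine lt_of_eq_of_lt ?_ hm
  have : Real.exp (-(b * m)) = Real.exp (2 * b) * Real.exp (-(b * (m + 2))) := by
    rw [← Real.exp_add]; ring_nf
  rw [Function.comp_apply, mul_pow, this]
  field_simp

namespace QuasiEllipticSystem

variable {τ : ℂ} {hτ : 0 < τ.im} {F X Y : ℂ → ℂ} {c κ : ℂ}

open NumberField in
/-- The Diophantine inequality obtained from an auxiliary function with `4 n²` coefficients. -/
lemma exists_one_le {K : Type} [Field K] [NumberField K] (σ : K →+* ℂ) (p q e : 𝓞 K)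
    (sys : QuasiEllipticSystem τ hτ F X Y c (σ p) (σ q) (σ e) κ) :
    ∃ (A b : ℝ) (k : ℕ), 0 < b ∧ ∀ n : ℕ, 0 < n → ∃ m : ℕ, 2 * n ^ 2 < (m + 2) ^ 4 ∧
      1 ≤ A * ((m : ℝ) + 2) ^ k * Real.exp (-(b * m)) := by
  obtain ⟨H, hH, hHp, hHq, hHe⟩ : ∃ H : ℝ, 1 ≤ H ∧ (∀ φ : K →+* ℂ, ‖φ p‖ ≤ H) ∧
      (∀ φ : K →+* ℂ, ‖φ q‖ ≤ H) ∧ ∀ φ : K →+* ℂ, ‖φ e‖ ≤ H :=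
    ⟨max (max 1 (house (p : K))) (max (house (q : K)) (house (e : K))), by simp,
      fun φ => (norm_embedding_le_house _ φ).trans (by simp),
      fun φ => (norm_embedding_le_house _ φ).trans (by simp),
      fun φ => (norm_embedding_le_house _ φ).trans (by simp)⟩
  obtain ⟨S, hS1, hS⟩ := exists_siegel K
  obtain ⟨C, b, hC, hb, hbound⟩ := sys.exists_norm_iteratedDeriv_le
  set D := Module.finrank ℚ K - 1 with hD
  set M₁ : ℝ := ‖c‖ * (48 * S * H ^ 4) * C ^ 3 with hM₁
  set M₂ : ℝ := 4 * (48 * S * H ^ 4) * (24 * H ^ 4) with hM₂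
  refine ⟨M₁ * M₂ ^ D, b, 8 * (D + 1), hb, fun n hn => ?_⟩
  have hjet : ∀ t : ℕ, 2 * n ^ 2 ≤ t → ∀ k ≤ t, ∀ i < 2 * n, ∀ j < 2 * n, ∀ φ : K →+* ℂ,
      ‖φ (jet p q e k i j 0 : 𝓞 K)‖ ≤ (24 * H ^ 4 * t) ^ t := by
    intro t ht k hk i hi j hj φ
    have h1 : φ (jet p q e k i j 0 : 𝓞 K) = jet (φ p) (φ q) (φ e) k i j 0 :=
      map_jet (φ.comp (algebraMap (𝓞 K) K)) p q e k i j 0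
    have h4n : 4 * n ≤ 2 * t := by nlinarith
    have ht1 : 1 ≤ t := by nlinarith
    have h3t : ((4 * n + k : ℕ) : ℝ) ≤ 3 * t := by exact_mod_cast (by omega)
    have ht1' : (1 : ℝ) ≤ t := by exact_mod_cast ht1
    rw [h1]
    refine (norm_jet_le hH (hHp φ) (hHq φ) (hHe φ) k (4 * n) i j 0 (by omega)).trans ?_
    calc (8 * H) ^ k * ((4 * n + k : ℕ) : ℝ) ^ k * H ^ (4 * n + k)
        ≤ (8 * H) ^ k * (3 * t) ^ k * H ^ (3 * t) := by
          gcongr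
          omega
      _ ≤ (8 * H) ^ t * (3 * t) ^ t * H ^ (3 * t) := by
          gcongr
          · linarith
          · linarith
      _ = (24 * H ^ 4 * t) ^ t := by
          rw [pow_mul, ← mul_pow, ← mul_pow]; ring
  have hn2 : 0 < 2 * n ^ 2 := by positivity
  let a : Matrix (Fin (2 * n ^ 2)) (Fin (2 * n) × Fin (2 * n)) (𝓞 K) :=
    fun k x => jet p q e k x.1 x.2 0
  have ha : a ≠ 0 := fun h => by
    have h1 := congrFun (congrFun h ⟨0, hn2⟩) (⟨0, by omega⟩, ⟨0, by omega⟩)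
    simp [a, jet] at h1
  obtain ⟨ξ, hξ0, hξ, hξb⟩ := hS n hn a ha _ fun k x => house_le fun φ =>
    hjet (2 * n ^ 2) le_rfl k k.2.le x.1 x.1.2 x.2 x.2.2 φ
  set ξ' : Fin (2 * n) × Fin (2 * n) → ℂ := fun x => σ (ξ x) with hξ'
  have hσinj : ∀ {x : 𝓞 K}, σ x = 0 → x = 0 := fun {x} hx => by
    have := (map_eq_zero σ).mp hx
    exact_mod_cast this
  have hξ'0 : ξ' ≠ 0 := fun h => hξ0 <| funext fun x => hσinj (congrFun h x)
  have hsum : ∀ k, c ^ k * iteratedDeriv k (auxiliary F X ξ') (1 / 2) =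
      σ (∑ x, ξ x * jet p q e k x.1 x.2 0 : 𝓞 K) := by
    intro k
    rw [sys.pow_mul_iteratedDeriv_auxiliary]
    have h1 : σ (∑ x, ξ x * jet p q e k x.1 x.2 0 : 𝓞 K) =
        ∑ x, σ (ξ x) * σ (jet p q e k x.1 x.2 0 : 𝓞 K) := by
      change (σ.comp (algebraMap (𝓞 K) K)) _ = _
      rw [map_sum]
      exact Finset.sum_congr rfl fun x _ => map_mul _ _ _
    rw [h1]
    refine Finset.sum_congr rfl fun x _ => ?_
    congr 1
    exact (map_jet (σ.comp (algebraMap (𝓞 K) K)) p q e k x.1 x.2 0).symm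
  obtain ⟨t, ht0, htlt⟩ := sys.exists_first_nonvanishing hξ'0
  have htn : 2 * n ^ 2 ≤ t := by
    by_contra! hlt
    have h1 := congrFun hξ ⟨t, hlt⟩
    have h2 := hsum t
    have h3 : (∑ x, ξ x * jet p q e t x.1 x.2 0 : 𝓞 K) = 0 := by
      rw [← show _ = (0 : 𝓞 K) from h1]
      exact Finset.sum_congr rfl fun x _ => mul_comm _ _
    rw [h3] at h2
    exact mul_ne_zero (pow_ne_zero t sys.c_ne) ht0 (h2.trans (by simp))
  have ht1 : 1 ≤ t := hn2.trans_le htn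
  have ht1' : (1 : ℝ) ≤ t := by exact_mod_cast ht1
  have htn' : 2 * (n : ℝ) ^ 2 ≤ t := by exact_mod_cast htn
  have ht2 : (t : ℝ) ≤ 2 ^ t := by exact_mod_cast t.lt_two_pow_self.le
  obtain ⟨m, hm1, hm2⟩ := exists_fourth_root ht1
  refine ⟨m, htn.trans_lt hm2, ?_⟩
  set α : 𝓞 K := ∑ x, ξ x * jet p q e t x.1 x.2 0 with hα
  have hα0 : α ≠ 0 := fun h => by
    have h2 := hsum t
    rw [← hα, h] at h2
    exact mul_ne_zero (pow_ne_zero t sys.c_ne) ht0 (h2.trans (by simp))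
  set B : ℝ := (48 * S * H ^ 4 * t) ^ t with hB
  have hξB : ∀ x (φ : K →+* ℂ), ‖φ (ξ x)‖ ≤ B := by
    intro x φ
    refine (norm_embedding_le_house _ φ).trans ((hξb x).trans ?_)
    have hSt : S ≤ S ^ t := le_self_pow₀ hS1 (by omega)
    have hJ : (24 * H ^ 4 * ((2 * n ^ 2 : ℕ) : ℝ)) ^ (2 * n ^ 2) ≤ (24 * H ^ 4 * t) ^ t := by
      have hH4 : 1 ≤ H ^ 4 := one_le_pow₀ hH
      calc _ ≤ (24 * H ^ 4 * (t : ℝ)) ^ (2 * n ^ 2) := by gcongr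
        _ ≤ _ := pow_le_pow_right₀ (by nlinarith) htn
    calc S * n ^ 2 * (24 * H ^ 4 * ((2 * n ^ 2 : ℕ) : ℝ)) ^ (2 * n ^ 2)
        ≤ S ^ t * 2 ^ t * (24 * H ^ 4 * t) ^ t := by
          gcongr
          nlinarith
      _ = B := by rw [hB, ← mul_pow, ← mul_pow]; ring
  have hB0 : 0 ≤ B := by positivity
  have hαb : ∀ φ : K →+* ℂ, ‖φ α‖ ≤ (M₂ * t ^ 2) ^ t := by
    intro φ
    have h1 : φ α = ∑ x, φ (ξ x) * φ (jet p q e t x.1 x.2 0 : 𝓞 K) := by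
      have h1 : ∀ y : 𝓞 K, φ y = (φ.comp (algebraMap (𝓞 K) K)) y := fun y => rfl
      rw [h1, hα, map_sum]
      exact Finset.sum_congr rfl fun x _ => map_mul _ _ _
    rw [h1]
    calc _ ≤ ∑ _x : Fin (2 * n) × Fin (2 * n), B * (24 * H ^ 4 * t) ^ t := by
          refine norm_sum_le_of_le _ fun x _ => ?_
          rw [norm_mul]
          gcongr
          · exact hξB x φ
          · exact hjet t htn t le_rfl x.1 x.1.2 x.2 x.2.2 φ
      _ = (4 * (n : ℝ) ^ 2) * (B * (24 * H ^ 4 * t) ^ t) := by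
          simp only [Finset.sum_const, Finset.card_univ, Fintype.card_prod, Fintype.card_fin,
            nsmul_eq_mul]
          push_cast; ring
      _ ≤ (2 ^ t * 2 ^ t) * (B * (24 * H ^ 4 * t) ^ t) := by
          have h2 : (2 : ℝ) ≤ 2 ^ t := le_self_pow₀ (by norm_num) (by omega)
          exact mul_le_mul_of_nonneg_right (by nlinarith) (by positivity)
      _ = (M₂ * t ^ 2) ^ t := by
          rw [hB, ← mul_pow, ← mul_pow, ← mul_pow, hM₂]; ring
  have hLm : 2 * n * (m + 1) ^ 2 ≤ 2 * t := by
    refine (pow_le_pow_iff_left₀ (Nat.zero_le _) (Nat.zero_le _) two_ne_zero).mp ?_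
    calc (2 * n * (m + 1) ^ 2) ^ 2 = 2 * (2 * n ^ 2) * (m + 1) ^ 4 := by ring
      _ ≤ 2 * t * t := by gcongr
      _ ≤ (2 * t) ^ 2 := by nlinarith
  have hσα : ‖σ α‖ ≤ (M₁ * t ^ 2 * Real.exp (-(b * m))) ^ t := by
    rw [← hsum t, norm_mul, norm_pow]
    have h1 := hbound (2 * n) t m ξ' B hB0 (fun x => hξB x σ) htlt
    calc _ ≤ ‖c‖ ^ t * (B * t ^ t * C ^ t * C ^ (2 * t) * Real.exp (-(b * m * t))) := by
          gcongr
          refine h1.trans ?_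
          gcongr
          exact_mod_cast t.factorial_le_pow
      _ = _ := by
          rw [show -(b * m * t) = t * (-(b * m)) by ring, Real.exp_nat_mul, hB, pow_mul C 2,
            ← mul_pow, ← mul_pow, ← mul_pow, ← mul_pow, ← mul_pow, hM₁]
          ring
  have hfin := (one_le_norm_mul_pow hα0 hαb σ).trans
    (mul_le_mul_of_nonneg_right hσα (by positivity))
  rw [← hD, ← pow_mul, mul_comm t D, pow_mul, ← mul_pow] at hfin
  have hbase : 1 ≤ M₁ * t ^ 2 * Real.exp (-(b * m)) * (M₂ * t ^ 2) ^ D := by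
    by_contra! hlt
    exact absurd hfin (not_le.mpr (pow_lt_one₀ (by positivity) hlt (by omega)))
  have htm : (t : ℝ) ≤ ((m : ℝ) + 2) ^ 4 := by exact_mod_cast hm2.le
  calc 1 ≤ M₁ * t ^ 2 * Real.exp (-(b * m)) * (M₂ * t ^ 2) ^ D := hbase
    _ = M₁ * M₂ ^ D * (t ^ (2 * (D + 1))) * Real.exp (-(b * m)) := by
        rw [mul_pow, ← pow_mul]; ring
    _ ≤ M₁ * M₂ ^ D * ((((m : ℝ) + 2) ^ 4) ^ (2 * (D + 1))) * Real.exp (-(b * m)) := by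
        gcongr
    _ = _ := by rw [← pow_mul]; ring_nf

/-- The parameters of a quasi-elliptic system cannot all be algebraic integers. -/
theorem false_of_isIntegral {p q e : ℂ} (sys : QuasiEllipticSystem τ hτ F X Y c p q e κ)
    (hp : IsIntegral ℤ p) (hq : IsIntegral ℤ q) (he : IsIntegral ℤ e) : False := by
  obtain ⟨K, _, _, σ, p', q', e', rfl, rfl, rfl⟩ := exists_numberField hp hq he
  obtain ⟨A, b, k, hb, h⟩ := exists_one_le σ p' q' e' sys
  obtain ⟨m₀, hm₀⟩ := eventually_atTop.mp (eventually_mul_pow_mul_exp_lt_one A hb k)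
  obtain ⟨m, hm1, hm2⟩ := h ((m₀ + 2) ^ 4) (by positivity)
  refine absurd hm2 (not_le.mpr (hm₀ m ?_))
  by_contra! hlt
  have h1 : (m + 2) ^ 4 ≤ (m₀ + 2) ^ 4 := by gcongr
  nlinarith [pow_pos (by omega : 0 < m₀ + 2) 4]

end QuasiEllipticSystem

/-- The function `π cot (π w)`. -/
noncomputable def piCot (w : ℂ) : ℂ := Real.pi * cot (Real.pi * w)

lemma piCot_add_one (w : ℂ) : piCot (w + 1) = piCot w := by
  simp [piCot, Complex.cot, mul_add, Complex.sin_add_pi, Complex.cos_add_pi]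

lemma piCot_neg (w : ℂ) : piCot (-w) = -piCot w := by
  simp [piCot, Complex.cot, div_neg]

lemma piCot_half : piCot (1 / 2) = 0 := by
  simp [piCot, Complex.cot, show (Real.pi : ℂ) * 2⁻¹ = Real.pi / 2 by ring]

lemma sin_pi_mul_eq_zero_iff {w : ℂ} : sin (Real.pi * w) = 0 ↔ ∃ k : ℤ, w = k := by
  have hpi : (Real.pi : ℂ) ≠ 0 := by exact_mod_cast Real.pi_ne_zero
  rw [Complex.sin_eq_zero_iff]
  refine exists_congr fun k => ?_
  rw [mul_comm, mul_left_inj' hpi]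

lemma hasDerivAt_piCot {w : ℂ} (hw : sin (Real.pi * w) ≠ 0) :
    HasDerivAt piCot (-(Real.pi / sin (Real.pi * w)) ^ 2) w := by
  have h1 : HasDerivAt (fun w : ℂ => (Real.pi : ℂ) * w) Real.pi w := by
    simpa using (hasDerivAt_id w).const_mul (Real.pi : ℂ)
  have h := ((h1.ccos).fun_div (h1.csin) hw).const_mul (Real.pi : ℂ)
  refine HasDerivAt.congr_deriv (f := piCot) h ?_
  have := Complex.sin_sq_add_cos_sq (Real.pi * w)
  field_simp
  linear_combination -this

lemma mul_abs_im_le_norm_sin (w : ℂ) : Real.pi * |w.im| ≤ ‖sin (Real.pi * w)‖ := by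
  refine le_trans ?_ (sinh_abs_im_le_norm_sin _)
  rw [Complex.im_ofReal_mul, abs_mul, abs_of_pos Real.pi_pos]
  exact Real.self_le_sinh_iff.mpr (by positivity)

lemma piCot_add_piCot {v w : ℂ} (hv : sin (Real.pi * v) ≠ 0) (hw : sin (Real.pi * w) ≠ 0) :
    piCot v + piCot w =
      Real.pi * sin (Real.pi * (v + w)) / (sin (Real.pi * v) * sin (Real.pi * w)) := by
  rw [mul_add, Complex.sin_add, piCot, piCot, Complex.cot, Complex.cot]
  field_simp
  ring

lemma norm_piCot_add_I_le {w : ℂ} (hw : 0 < w.im) : ‖piCot w + Real.pi * I‖ ≤ 1 / w.im := by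
  have hs : 0 < ‖sin (Real.pi * w)‖ := lt_of_lt_of_le (by positivity) (mul_abs_im_le_norm_sin w)
  have h : piCot w + Real.pi * I = Real.pi * exp (Real.pi * w * I) / sin (Real.pi * w) := by
    have := norm_pos_iff.mp hs
    rw [piCot, Complex.cot, Complex.exp_mul_I]
    field_simp
  have he : ‖exp (Real.pi * w * I)‖ ≤ 1 := by
    rw [Complex.norm_exp, Real.exp_le_one_iff]
    simpa using mul_nonneg Real.pi_pos.le hw.le
  rw [h, norm_div, norm_mul, Complex.norm_real, Real.norm_of_nonneg Real.pi_pos.le,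
    div_le_div_iff₀ hs hw]
  have := mul_abs_im_le_norm_sin w
  rw [abs_of_pos hw] at this
  nlinarith [Real.pi_pos, mul_pos Real.pi_pos hw]

/-- The sum of `π cot (π (u - n τ))` over `n = ±(k + 1)`. -/
noncomputable def cotPair (τ : ℂ) (k : ℕ) (u : ℂ) : ℂ :=
  piCot (u - (k + 1) * τ) + piCot (u + (k + 1) * τ)

/-- The sum of `π cot (π (u - n τ))` over `n ≠ 0`, taken symmetrically. -/
noncomputable def cotSum (τ : ℂ) (u : ℂ) : ℂ := ∑' k, cotPair τ k u

/-- The Eisenstein sum of `π cot (π (u - n τ))` over all integers `n`. -/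
noncomputable def quasi (τ : ℂ) (u : ℂ) : ℂ := piCot u + cotSum τ u

variable {τ : ℂ}

lemma norm_cotPair_le (hτ : 0 < τ.im) {R : ℝ} {k : ℕ} (hk : 2 * R ≤ (k + 1) * τ.im)
    {u : ℂ} (hu : |u.im| ≤ R) :
    ‖cotPair τ k u‖ ≤
      Real.pi * Real.exp (2 * Real.pi * R) * (2 / (Real.pi * τ.im)) ^ 2 / ((k : ℝ) + 1) ^ 2 := by
  have hu' := abs_le.mp hu
  set a : ℝ := Real.pi * ((k + 1) * τ.im / 2) with ha
  have ha0 : 0 < a := by positivity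
  have h1 : a ≤ ‖sin (Real.pi * (u - (k + 1) * τ))‖ := by
    refine le_trans ?_ (mul_abs_im_le_norm_sin _)
    refine mul_le_mul_of_nonneg_left ?_ Real.pi_pos.le
    rw [le_abs]
    right
    simp
    linarith
  have h2 : a ≤ ‖sin (Real.pi * (u + (k + 1) * τ))‖ := by
    refine le_trans ?_ (mul_abs_im_le_norm_sin _)
    refine mul_le_mul_of_nonneg_left ?_ Real.pi_pos.le
    rw [le_abs]
    left
    simp
    linarith
  rw [cotPair, piCot_add_piCot (norm_pos_iff.mp (ha0.trans_le h1))
    (norm_pos_iff.mp (ha0.trans_le h2)), norm_div, norm_mul, norm_mul, Complex.norm_real,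
    Real.norm_of_nonneg Real.pi_pos.le]
  have h3 : ‖sin (Real.pi * (u - (k + 1) * τ + (u + (k + 1) * τ)))‖ ≤
      Real.exp (2 * Real.pi * R) := by
    refine (norm_sin_le _).trans (Real.exp_le_exp.mpr ?_)
    rw [show u - (k + 1) * τ + (u + (k + 1) * τ) = (2 : ℝ) * u by push_cast; ring,
      Complex.im_ofReal_mul, Complex.im_ofReal_mul, abs_mul, abs_mul, abs_of_pos Real.pi_pos,
      abs_two]
    nlinarith [Real.pi_pos]
  calc _ ≤ Real.pi * Real.exp (2 * Real.pi * R) / (a * a) := by gcongr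
    _ = _ := by rw [ha]; field_simp

lemma tendstoUniformlyOn_cotSum (hτ : 0 < τ.im) (R : ℝ) :
    TendstoUniformlyOn (fun N u => ∑ k ∈ Finset.range N, cotPair τ k u) (cotSum τ) atTop
      {u | |u.im| ≤ R} := by
  have hs : Summable fun k : ℕ => Real.pi * Real.exp (2 * Real.pi * R) *
      (2 / (Real.pi * τ.im)) ^ 2 / ((k : ℝ) + 1) ^ 2 := by
    have := (summable_nat_add_iff 1).mpr (Real.summable_one_div_nat_pow.mpr one_lt_two)
    refine (this.mul_left (Real.pi * Real.exp (2 * Real.pi * R) *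
      (2 / (Real.pi * τ.im)) ^ 2)).congr fun k => ?_
    push_cast
    ring
  refine tendstoUniformlyOn_tsum_nat_eventually hs ?_
  have ht : Tendsto (fun k : ℕ => ((k : ℝ) + 1) * τ.im) atTop atTop :=
    (tendsto_atTop_add_const_right _ 1 tendsto_natCast_atTop_atTop).atTop_mul_const hτ
  filter_upwards [ht.eventually_ge_atTop (2 * R)] with k hk u hu
  exact norm_cotPair_le hτ hk hu

lemma tendstoLocallyUniformlyOn_cotSum (hτ : 0 < τ.im) (s : Set ℂ) :
    TendstoLocallyUniformlyOn (fun N u => ∑ k ∈ Finset.range N, cotPair τ k u) (cotSum τ) atTop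
      s := by
  refine tendstoLocallyUniformlyOn_of_forall_exists_nhds fun u _ =>
    ⟨{v | |v.im| < |u.im| + 1}, ?_, ?_⟩
  · exact nhdsWithin_le_nhds ((isOpen_lt (by fun_prop) (by fun_prop)).mem_nhds (by simp))
  · exact (tendstoUniformlyOn_cotSum hτ (|u.im| + 1)).mono fun v (hv : |v.im| < |u.im| + 1) => hv.le

lemma tendsto_cotSum (hτ : 0 < τ.im) (u : ℂ) :
    Tendsto (fun N => ∑ k ∈ Finset.range N, cotPair τ k u) atTop (𝓝 (cotSum τ u)) :=
  (tendstoUniformlyOn_cotSum hτ |u.im|).tendsto_at (by simp)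

lemma sin_pi_mul_ne_zero {u : ℂ} (n : ℤ)
    (hu : ∀ m : ℤ, u ≠ m + n * τ) : sin (Real.pi * (u - n * τ)) ≠ 0 := fun h => by
  obtain ⟨m, hm⟩ := sin_pi_mul_eq_zero_iff.mp h
  exact hu m (by linear_combination hm)

/-- The derivative `-(π / sin π (u - n τ))²`, summed over `n = ±(k + 1)`. -/
noncomputable def sinPair (τ : ℂ) (k : ℕ) (u : ℂ) : ℂ :=
  (Real.pi / sin (Real.pi * (u - (k + 1) * τ))) ^ 2 +
    (Real.pi / sin (Real.pi * (u + (k + 1) * τ))) ^ 2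

lemma hasDerivAt_cotPair (hτ : 0 < τ.im) {u : ℂ}
    (hu : u ∈ ((pair τ hτ).lattice \ {0} : Set ℂ)ᶜ) (k : ℕ) :
    HasDerivAt (cotPair τ k) (-sinPair τ k u) u := by
  have key : ∀ n : ℤ, n ≠ 0 → sin (Real.pi * (u - n * τ)) ≠ 0 := fun n hn => by
    refine sin_pi_mul_ne_zero n fun m hm => hu ⟨mem_pair_lattice.mpr ⟨m, n, hm.symm⟩, ?_⟩
    rintro rfl
    have := congrArg Complex.im hm
    simp at this
    rcases this with h | h
    · exact hn h
    · exact hτ.ne' h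
  have k1 := key (k + 1) (by omega)
  have k2 := key (-(k + 1)) (by omega)
  push_cast at k1 k2
  rw [neg_mul, sub_neg_eq_add] at k2
  have := ((hasDerivAt_piCot k1).comp_sub_const u _).add ((hasDerivAt_piCot k2).comp_add_const u _)
  refine HasDerivAt.congr_deriv (f := cotPair τ k) this ?_
  rw [sinPair]; ring

lemma differentiableOn_cotSum (hτ : 0 < τ.im) :
    DifferentiableOn ℂ (cotSum τ) ((pair τ hτ).lattice \ {0} : Set ℂ)ᶜ :=
  (tendstoLocallyUniformlyOn_cotSum hτ _).differentiableOn
    (Eventually.of_forall fun _ => DifferentiableOn.fun_sum fun k _ _ hu =>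
      (hasDerivAt_cotPair hτ hu k).differentiableAt.differentiableWithinAt)
    (pair τ hτ).isOpen_compl_lattice_sdiff

lemma tendsto_deriv_cotSum (hτ : 0 < τ.im) {u : ℂ}
    (hu : u ∈ ((pair τ hτ).lattice \ {0} : Set ℂ)ᶜ) :
    Tendsto (fun N => -∑ k ∈ Finset.range N, sinPair τ k u) atTop (𝓝 (deriv (cotSum τ) u)) := by
  have h := ((tendstoLocallyUniformlyOn_cotSum hτ _).deriv
    (Eventually.of_forall fun _ => DifferentiableOn.fun_sum fun k _ _ hu =>
      (hasDerivAt_cotPair hτ hu k).differentiableAt.differentiableWithinAt)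
    (pair τ hτ).isOpen_compl_lattice_sdiff).tendsto_at hu
  refine h.congr fun N => ?_
  rw [Function.comp_apply, ← Finset.sum_neg_distrib]
  exact (HasDerivAt.fun_sum fun k _ => hasDerivAt_cotPair hτ hu k).deriv

lemma hasDerivAt_quasi (hτ : 0 < τ.im) {u : ℂ} (hu : u ∉ (pair τ hτ).lattice) :
    HasDerivAt (quasi τ) (-(Real.pi / sin (Real.pi * u)) ^ 2 + deriv (cotSum τ) u) u := by
  have h0 : sin (Real.pi * u) ≠ 0 := fun h => by
    obtain ⟨k, rfl⟩ := sin_pi_mul_eq_zero_iff.mp h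
    exact hu (mem_pair_lattice.mpr ⟨k, 0, by simp⟩)
  exact (hasDerivAt_piCot h0).add (((differentiableOn_cotSum hτ).differentiableAt
    ((pair τ hτ).isOpen_compl_lattice_sdiff.mem_nhds fun h => hu h.1)).hasDerivAt)

lemma quasi_add_one (u : ℂ) : quasi τ (u + 1) = quasi τ u := by
  simp only [quasi, cotSum, cotPair, piCot_add_one, add_right_comm u 1, add_sub_right_comm]

lemma quasi_half : quasi τ (1 / 2) = 0 := by
  have : ∀ k, cotPair τ k (1 / 2) = 0 := fun k => by
    have h := piCot_neg (1 / 2 - (k + 1) * τ)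
    rw [← piCot_add_one, show -(1 / 2 - (k + 1) * τ) + 1 = 1 / 2 + (k + 1) * τ by ring] at h
    rw [cotPair, h, add_neg_cancel]
  simp only [quasi, cotSum, this, tsum_zero, piCot_half, add_zero]

lemma quasi_add_tau (hτ : 0 < τ.im) (u : ℂ) : quasi τ (u + τ) = quasi τ u - 2 * Real.pi * I := by
  have htel : ∀ N : ℕ, (piCot (u + τ) + ∑ k ∈ Finset.range N, cotPair τ k (u + τ)) -
      (piCot u + ∑ k ∈ Finset.range N, cotPair τ k u) =
        piCot (u + (N + 1) * τ) + piCot (N * τ - u) := by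
    intro N
    induction N with
    | zero => 
      have := piCot_neg u
      simp only [Finset.range_zero, Finset.sum_empty, Nat.cast_zero, zero_add, zero_mul, one_mul,
        add_zero, zero_sub, this]
      ring
    | succ N ih =>
      rw [Finset.sum_range_succ, Finset.sum_range_succ]
      have h1 := piCot_neg (u - N * τ)
      have h2 := piCot_neg (u - (N + 1) * τ)
      rw [neg_sub] at h1 h2
      rw [h1] at ih
      push_cast
      rw [h2, cotPair, cotPair, show u + τ - (N + 1) * τ = u - N * τ by ring,
        show u + τ + (N + 1) * τ = u + (N + 1 + 1) * τ by ring]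
      linear_combination ih
  have hlim : ∀ v : ℂ, Tendsto (fun N : ℕ => piCot (N * τ + v)) atTop (𝓝 (-(Real.pi * I))) := by
    intro v
    have ht : Tendsto (fun N : ℕ => ((N : ℂ) * τ + v).im) atTop atTop := by
      simpa using tendsto_atTop_add_const_right _ v.im
        (tendsto_natCast_atTop_atTop.atTop_mul_const hτ)
    rw [tendsto_iff_norm_sub_tendsto_zero]
    refine squeeze_zero' (Eventually.of_forall fun _ => norm_nonneg _) ?_
      (tendsto_inv_atTop_zero.comp ht)
    filter_upwards [ht.eventually_gt_atTop 0] with N hN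
    simpa using norm_piCot_add_I_le hN
  have h1 := ((tendsto_cotSum hτ (u + τ)).const_add (piCot (u + τ))).sub
    ((tendsto_cotSum hτ u).const_add (piCot u))
  have h2 := (hlim (u + τ)).add (hlim (-u))
  have := tendsto_nhds_unique (h1.congr htel) (h2.congr fun N => by ring_nf)
  rw [quasi, quasi]
  linear_combination this

lemma removable_mul_quasi (hτ : 0 < τ.im) : Removable (fun u => u * quasi τ u) 0 := by
  have hs : AnalyticAt ℂ (fun u : ℂ => sin (Real.pi * u)) 0 := by fun_prop
  have hd : HasDerivAt (fun u : ℂ => sin (Real.pi * u)) Real.pi 0 := by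
    simpa using (((hasDerivAt_id (0 : ℂ)).const_mul (Real.pi : ℂ)).csin)
  have hds := analyticAt_dslope hs
  have hne : dslope (fun u : ℂ => sin (Real.pi * u)) 0 0 ≠ 0 := by
    rw [dslope_same, hd.deriv]
    exact_mod_cast Real.pi_ne_zero
  have hc : AnalyticAt ℂ (cotSum τ) 0 := (differentiableOn_cotSum hτ).analyticAt
    ((pair τ hτ).compl_lattice_sdiff_singleton_mem_nhds 0)
  refine ⟨fun u => Real.pi * cos (Real.pi * u) / dslope (fun u : ℂ => sin (Real.pi * u)) 0 u +
    u * cotSum τ u, ?_, ?_⟩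
  · exact ((AnalyticAt.fun_div (by fun_prop) hds hne)).fun_add (by fun_prop)
  · filter_upwards [self_mem_nhdsWithin] with u hu
    have hu : u ≠ 0 := hu
    have h := eq_sub_mul_dslope (f := fun u : ℂ => sin (Real.pi * u)) (a := 0) (by simp) u
    simp only [sub_zero] at h
    rw [quasi, piCot, Complex.cot, h, mul_add, div_eq_mul_inv, mul_inv, div_eq_mul_inv]
    field_simp

lemma hasSum_one_div_add_sq_of_pos {w : ℂ} (hw : 0 < w.im) :
    HasSum (fun m : ℤ => 1 / (w + m) ^ 2) ((Real.pi / sin (Real.pi * w)) ^ 2) := by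
  have hs : Summable fun m : ℤ => 1 / (w + m) ^ 2 := by
    simpa [zpow_ofNat] using EisensteinSeries.linear_right_summable w 1 (k := 2) le_rfl
  have hne : sin (Real.pi * w) ≠ 0 := fun h => by
    obtain ⟨k, rfl⟩ := sin_pi_mul_eq_zero_iff.mp h
    simp at hw
  have h := iteratedDerivWithin_cot_pi_mul_eq_mul_tsum_div_pow (k := 1) le_rfl (z := w) hw
  rw [iteratedDerivWithin_one, derivWithin_of_isOpen UpperHalfPlane.isOpen_upperHalfPlaneSet hw,
    show (fun x : ℂ => Real.pi * cot (Real.pi * x)) = piCot from rfl,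
    (hasDerivAt_piCot hne).deriv] at h
  have h' : (Real.pi / sin (Real.pi * w)) ^ 2 = ∑' m : ℤ, 1 / (w + m) ^ 2 := by
    simpa using h
  rw [h']
  exact hs.hasSum

lemma hasSum_one_div_add_sq {w : ℂ} (hw : w.im ≠ 0) :
    HasSum (fun m : ℤ => 1 / (w + m) ^ 2) ((Real.pi / sin (Real.pi * w)) ^ 2) := by
  rcases hw.lt_or_gt with h | h
  · have := (hasSum_one_div_add_sq_of_pos (w := -w) (by simpa using h))
    rw [← (Equiv.neg ℤ).hasSum_iff] at this
    convert! this using 1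
    · ext m
      simp only [Function.comp_apply, Equiv.neg_apply, Int.cast_neg]
      rw [← neg_add, neg_sq]
    · rw [mul_neg, sin_neg, div_neg, neg_sq]
  · exact hasSum_one_div_add_sq_of_pos h

lemma sum_Icc_neg {M : Type*} [AddCommMonoid M] (f : ℤ → M) (N : ℕ) :
    ∑ n ∈ Finset.Icc (-(N : ℤ)) N, f n =
      f 0 + ∑ k ∈ Finset.range N, (f (k + 1) + f (-(k + 1))) := by
  induction N with
  | zero => simp
  | succ N ih =>
    rw [Finset.sum_range_succ, ← add_assoc, ← ih, Nat.cast_succ]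
    have : Finset.Icc (-((N : ℤ) + 1)) (N + 1) =
        insert ((N : ℤ) + 1) (insert (-((N : ℤ) + 1)) (Finset.Icc (-(N : ℤ)) N)) := by
      ext x; simp only [Finset.mem_Icc, Finset.mem_insert]; omega
    rw [this, Finset.sum_insert (by simp; omega), Finset.sum_insert (by simp)]
    abel

lemma hasSum_symmetric_weierstrassP (hτ : 0 < τ.im) {u : ℂ} (hu : 0 < u.im) (hu' : u.im < τ.im) :
    HasSum (fun n : ℤ => (Real.pi / sin (Real.pi * (u - n * τ))) ^ 2 -
      EisensteinSeries.e2Summand n ⟨τ, hτ⟩) ((pair τ hτ).weierstrassP u) := by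
  have h := (pair τ hτ).hasSum_weierstrassP u
  rw [← (pair τ hτ).latticeEquivProd.symm.toEquiv.hasSum_iff,
    ← (Equiv.prodComm ℤ ℤ).hasSum_iff] at h
  refine h.prod_fiberwise fun n => ?_
  have him : (u - n * τ).im ≠ 0 := by
    simp only [sub_im, mul_im, intCast_re, intCast_im, zero_mul, add_zero]
    intro h0
    rcases le_or_gt n 0 with hn | hn
    · have : (n : ℝ) ≤ 0 := by exact_mod_cast hn
      nlinarith
    · have : (1 : ℝ) ≤ n := by exact_mod_cast hn
      nlinarith
  have h1 := hasSum_one_div_add_sq him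
  rw [← (Equiv.neg ℤ).hasSum_iff] at h1
  have h2 := (EisensteinSeries.e2Summand_summable n ⟨τ, hτ⟩).hasSum
  convert! h1.sub h2 using 1
  ext m
  have e : (((pair τ hτ).latticeEquivProd.symm (m, n) : (pair τ hτ).lattice) : ℂ) = m + n * τ := by
    rw [PeriodPair.latticeEquiv_symm_apply]; simp [pair]
  simp only [Function.comp_apply, Equiv.prodComm_apply, Prod.swap_prod_mk, Equiv.neg_apply,
    LinearEquiv.coe_toEquiv, e, EisensteinSeries.eisSummand]
  congr 1
  · push_cast; ring
  · simp [zpow_neg, zpow_ofNat, add_comm]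

lemma tendsto_sum_Icc_of_hasSum {f : ℤ → ℂ} {a : ℂ}
    (h : HasSum f a (SummationFilter.symmetricIcc ℤ)) :
    Tendsto (fun N : ℕ => f 0 + ∑ k ∈ Finset.range N, (f (k + 1) + f (-(k + 1)))) atTop (𝓝 a) := by
  rw [SummationFilter.hasSum_symmetricIcc_iff] at h
  exact h.congr fun N => sum_Icc_neg f N

lemma deriv_quasi_eq_of_mem_strip (hτ : 0 < τ.im) {u : ℂ} (hu : 0 < u.im) (hu' : u.im < τ.im) :
    -(Real.pi / sin (Real.pi * u)) ^ 2 + deriv (cotSum τ) u =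
      -((pair τ hτ).weierstrassP u + EisensteinSeries.G2 ⟨τ, hτ⟩) := by
  have hmem : u ∈ ((pair τ hτ).lattice \ {0} : Set ℂ)ᶜ := fun h => by
    obtain ⟨m, n, rfl⟩ := mem_pair_lattice.mp h.1
    simp only [add_im, mul_im, intCast_re, intCast_im, zero_mul, add_zero, zero_add] at hu hu'
    have h1 : 0 < n := by exact_mod_cast (pos_iff_pos_of_mul_pos hu).mpr hτ
    have h2 : (1 : ℝ) ≤ n := by exact_mod_cast h1
    nlinarith
  have h1 : HasSum (fun n : ℤ => (Real.pi / sin (Real.pi * (u - n * τ))) ^ 2 -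
      EisensteinSeries.e2Summand n ⟨τ, hτ⟩) ((pair τ hτ).weierstrassP u)
      (SummationFilter.symmetricIcc ℤ) :=
    (hasSum_symmetric_weierstrassP hτ hu hu').mono_left SummationFilter.LeAtTop.le_atTop
  have h2 := (EisensteinSeries.summable_e2Summand_symmetricIcc ⟨τ, hτ⟩).hasSum
  have h3 := tendsto_sum_Icc_of_hasSum (h1.add h2)
  have h4 := (tendsto_deriv_cotSum hτ hmem).const_add (-(Real.pi / sin (Real.pi * u)) ^ 2)
  refine tendsto_nhds_unique h4 (h3.neg.congr fun N => ?_)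
  simp only [sub_add_cancel, neg_add, Int.cast_zero, zero_mul, sub_zero]
  congr 2
  refine Finset.sum_congr rfl fun k _ => ?_
  rw [sinPair]
  push_cast
  ring_nf

/-- The derivative of `quasi` is `-(℘ + G₂)`. -/
lemma hasDerivAt_quasi_weierstrassP (hτ : 0 < τ.im) {u : ℂ} (hu : u ∉ (pair τ hτ).lattice) :
    HasDerivAt (quasi τ)
      (-((pair τ hτ).weierstrassP u + EisensteinSeries.G2 ⟨τ, hτ⟩)) u := by
  set L := pair τ hτ
  have ho := isOpen_compl_lattice L
  have hd : DifferentiableOn ℂ (quasi τ) (L.lattice : Set ℂ)ᶜ := fun v hv =>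
    (hasDerivAt_quasi hτ hv).differentiableAt.differentiableWithinAt
  have ha : AnalyticOnNhd ℂ (deriv (quasi τ)) (L.lattice : Set ℂ)ᶜ := (hd.analyticOnNhd ho).deriv
  have hb : AnalyticOnNhd ℂ (fun v => -(L.weierstrassP v + EisensteinSeries.G2 ⟨τ, hτ⟩))
      (L.lattice : Set ℂ)ᶜ := (L.analyticOnNhd_weierstrassP.add analyticOnNhd_const).neg
  have him : (τ / 2).im = τ.im / 2 := by simp
  have hmem : τ / 2 ∈ (L.lattice : Set ℂ)ᶜ := L.ω₂_div_two_notMem_lattice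
  have hev : deriv (quasi τ) =ᶠ[𝓝 (τ / 2)]
      fun v => -(L.weierstrassP v + EisensteinSeries.G2 ⟨τ, hτ⟩) := by
    filter_upwards [ho.mem_nhds hmem,
      (isOpen_lt continuous_const continuous_im).mem_nhds (show 0 < (τ / 2).im by linarith),
      (isOpen_lt continuous_im continuous_const).mem_nhds (show (τ / 2).im < τ.im by linarith)]
      with v hv h1 h2
    rw [(hasDerivAt_quasi hτ hv).deriv]
    exact deriv_quasi_eq_of_mem_strip hτ h1 h2
  have := ha.eqOn_of_preconnected_of_eventuallyEq hb (isPreconnected_compl_lattice L) hmem hev hu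
  simp only at this
  rw [← this]
  exact (hd.differentiableAt (ho.mem_nhds hu)).hasDerivAt

lemma tendsto_weierstrassP_cobounded (L : PeriodPair) :
    Tendsto L.weierstrassP (𝓝[≠] 0) (Bornology.cobounded ℂ) :=
  tendsto_cobounded_of_meromorphicOrderAt_neg (by
    rw [L.order_weierstrassP 0 (zero_mem _)]; decide)

lemma exists_derivWeierstrassP_ne_zero (L : PeriodPair) :
    ∃ v ∈ (L.lattice : Set ℂ)ᶜ, L.derivWeierstrassP v ≠ 0 := by
  by_contra! h
  obtain ⟨a, ha⟩ := (isOpen_compl_lattice L).exists_is_const_of_deriv_eq_zero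
    (isPreconnected_compl_lattice L) L.differentiableOn_weierstrassP
    (fun v hv => by rw [L.deriv_weierstrassP]; exact h v hv)
  have h1 : ∀ᶠ v in 𝓝[≠] (0 : ℂ), L.weierstrassP v = a := by
    filter_upwards [mem_nhdsWithin_of_mem_nhds (L.compl_lattice_sdiff_singleton_mem_nhds 0),
      self_mem_nhdsWithin] with v hv hv0
    exact ha v fun hl => hv ⟨hl, hv0⟩
  have h2 := (tendsto_weierstrassP_cobounded L).eventually
    (Bornology.isBounded_def.mp (Bornology.isBounded_singleton (x := a)))
  obtain ⟨v, hv, hv'⟩ := (h1.and h2).exists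
  exact hv' hv

/-- `℘'' = 6 ℘² - g₂ / 2`. -/
lemma hasDerivAt_derivWeierstrassP (L : PeriodPair) {u : ℂ} (hu : u ∉ L.lattice) :
    HasDerivAt L.derivWeierstrassP (6 * L.weierstrassP u ^ 2 - L.g₂ / 2) u := by
  have ho := isOpen_compl_lattice L
  have hP : ∀ v ∈ (L.lattice : Set ℂ)ᶜ, HasDerivAt L.weierstrassP (L.derivWeierstrassP v) v :=
    fun v hv => by
      rw [← L.deriv_weierstrassP]
      exact (L.analyticOnNhd_weierstrassP v hv).differentiableAt.hasDerivAt
  have hP' : ∀ v ∈ (L.lattice : Set ℂ)ᶜ,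
      HasDerivAt L.derivWeierstrassP (deriv L.derivWeierstrassP v) v := fun v hv =>
    (L.analyticOnNhd_derivWeierstrassP v hv).differentiableAt.hasDerivAt
  have hmul : ∀ v ∈ (L.lattice : Set ℂ)ᶜ, L.derivWeierstrassP v *
      (deriv L.derivWeierstrassP v - (6 * L.weierstrassP v ^ 2 - L.g₂ / 2)) = 0 := fun v hv => by
    have h1 := (hP' v hv).pow 2
    have h2 := ((((hP v hv).pow 3).const_mul 4).sub ((hP v hv).const_mul L.g₂)).sub_const L.g₃
    have h3 := h1.unique (h2.congr_of_eventuallyEq (by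
      filter_upwards [ho.mem_nhds hv] with w hw
      exact L.derivWeierstrassP_sq w hw))
    norm_num at h3
    linear_combination h3 / 2
  have hA : AnalyticOnNhd ℂ (fun v => deriv L.derivWeierstrassP v -
      (6 * L.weierstrassP v ^ 2 - L.g₂ / 2)) (L.lattice : Set ℂ)ᶜ :=
    L.analyticOnNhd_derivWeierstrassP.deriv.sub
      ((analyticOnNhd_const.mul (L.analyticOnNhd_weierstrassP.pow 2)).sub analyticOnNhd_const)
  rcases AnalyticOnNhd.eq_zero_or_eq_zero_of_mul_eq_zero L.analyticOnNhd_derivWeierstrassP hA hmul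
    (isPreconnected_compl_lattice L) with h | h
  · obtain ⟨v, hv, hne⟩ := exists_derivWeierstrassP_ne_zero L
    exact absurd (h v hv) hne
  · exact (hP' u hu).congr_deriv (sub_eq_zero.mp (h u hu))

lemma tsum_sigmaC_mul_exp (j : ℕ) (τ : ℂ) :
    ∑' n : ℕ+, sigmaC j n * exp (2 * Real.pi * I * n * τ) =
      ∑' n : ℕ+, (ArithmeticFunction.sigma j n : ℂ) * exp (2 * Real.pi * I * τ) ^ (n : ℕ) := by
  refine tsum_congr fun n => ?_
  rw [← exp_nat_mul, sigmaC, ArithmeticFunction.sigma_apply]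
  push_cast
  ring_nf

lemma eisG₁_eq (hτ : 0 < τ.im) :
    eisG₁ τ = I / (2 * Real.pi) * EisensteinSeries.G2 ⟨τ, hτ⟩ := by
  have hpi : (Real.pi : ℂ) ≠ 0 := by exact_mod_cast Real.pi_ne_zero
  rw [eisG₁, tsum_sigmaC_mul_exp, EisensteinSeries.G2_eq_tsum_cexp, riemannZeta_two]
  simp
  field_simp
  ring

lemma pair_G_eq (hτ : 0 < τ.im) (k : ℕ) :
    (pair τ hτ).G k = ∑' v : Fin 2 → ℤ, EisensteinSeries.eisSummand k v ⟨τ, hτ⟩ := by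
  rw [PeriodPair.G, ← (pair τ hτ).latticeEquivProd.symm.toEquiv.tsum_eq,
    ← (Equiv.prodComm ℤ ℤ).tsum_eq, ← (finTwoArrowEquiv ℤ).tsum_eq]
  refine tsum_congr fun v => ?_
  have e : (((pair τ hτ).latticeEquivProd.symm (v 1, v 0) : (pair τ hτ).lattice) : ℂ) =
      v 0 * τ + v 1 := by
    rw [PeriodPair.latticeEquiv_symm_apply]; simp [pair, add_comm]
  simp [EisensteinSeries.eisSummand, e]

lemma eisG₂_eq (hτ : 0 < τ.im) :
    eisG₂ τ = -(1 / (4 * Real.pi ^ 2)) * (pair τ hτ).g₂ := by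
  have hpi : (Real.pi : ℂ) ≠ 0 := by exact_mod_cast Real.pi_ne_zero
  have hz : riemannZeta (4 : ℕ) = (Real.pi : ℂ) ^ 4 / 90 := by exact_mod_cast riemannZeta_four
  rw [eisG₂, tsum_sigmaC_mul_exp, PeriodPair.g₂, pair_G_eq,
    tsum_eisSummand_eq_tsum_sigma_mul_cexp_pow (by norm_num) (by decide), hz]
  norm_num [Nat.factorial]
  generalize (∑' n : ℕ+, (_ : ℂ)) = S
  field_simp
  ring_nf
  simp only [I_sq, I_pow_four]
  ring

lemma riemannZeta_six : riemannZeta 6 = (Real.pi : ℂ) ^ 6 / 945 := by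
  have h := riemannZeta_two_mul_nat (k := 3) (by norm_num)
  norm_num [show bernoulli 6 = 1 / 42 by decide +kernel, Nat.factorial] at h
  rw [h]; ring

lemma eisG₃_eq (hτ : 0 < τ.im) :
    eisG₃ τ = -(I / (8 * Real.pi ^ 3)) * (pair τ hτ).g₃ := by
  have hpi : (Real.pi : ℂ) ≠ 0 := by exact_mod_cast Real.pi_ne_zero
  have hz : riemannZeta (6 : ℕ) = (Real.pi : ℂ) ^ 6 / 945 := by exact_mod_cast riemannZeta_six
  rw [eisG₃, tsum_sigmaC_mul_exp, PeriodPair.g₃, pair_G_eq,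
    tsum_eisSummand_eq_tsum_sigma_mul_cexp_pow (by norm_num) (by decide), hz]
  norm_num [Nat.factorial]
  generalize (∑' n : ℕ+, (_ : ℂ)) = S
  field_simp
  ring_nf
  simp only [I_sq, show I ^ 6 = -1 by rw [pow_mul I 2 3, I_sq]; norm_num]
  ring

lemma derivWeierstrassP_half (hτ : 0 < τ.im) : (pair τ hτ).derivWeierstrassP (1 / 2) = 0 := by
  have h := (pair τ hτ).derivWeierstrassP_add_coe (-(1 / 2)) ⟨1, (pair τ hτ).ω₁_mem_lattice⟩
  rw [PeriodPair.derivWeierstrassP_neg, show (-(1 / 2) + (1 : ℂ)) = 1 / 2 by norm_num] at h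
  linear_combination h / 2

/-- The functions `c F₀`, `c² (℘ + G₂)`, `c³ ℘'`, where `F₀' = -(℘ + G₂)`. -/
lemma quasiEllipticSystem (hτ : 0 < τ.im) {c : ℂ} (hc : c ≠ 0) :
    QuasiEllipticSystem τ hτ (fun u => c * quasi τ u)
      (fun u => c ^ 2 * ((pair τ hτ).weierstrassP u + EisensteinSeries.G2 ⟨τ, hτ⟩))
      (fun u => c ^ 3 * (pair τ hτ).derivWeierstrassP u) c
      (-12 * (c ^ 2 * EisensteinSeries.G2 ⟨τ, hτ⟩))
      (6 * (c ^ 2 * EisensteinSeries.G2 ⟨τ, hτ⟩) ^ 2 - c ^ 4 * (pair τ hτ).g₂ / 2)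
      (c ^ 2 * ((pair τ hτ).weierstrassP (1 / 2) + EisensteinSeries.G2 ⟨τ, hτ⟩))
      (-(2 * Real.pi * I) * c) where
  c_ne := hc
  κ_ne := mul_ne_zero (neg_ne_zero.mpr two_pi_I_ne_zero) hc
  hasDerivAt_F u hu := ((hasDerivAt_quasi_weierstrassP hτ hu).const_mul c).congr_deriv (by
    field_simp)
  hasDerivAt_X u hu := by
    have h := ((pair τ hτ).analyticOnNhd_weierstrassP u hu).differentiableAt.hasDerivAt
    rw [PeriodPair.deriv_weierstrassP] at h
    exact ((h.add_const _).const_mul (c ^ 2)).congr_deriv (by field_simp)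
  hasDerivAt_Y u hu := ((hasDerivAt_derivWeierstrassP _ hu).const_mul (c ^ 3)).congr_deriv (by
    field_simp; ring)
  F_add_one u := by rw [quasi_add_one]
  X_add_one u := by
    rw [(pair τ hτ).weierstrassP_add_coe u ⟨1, (pair τ hτ).ω₁_mem_lattice⟩]
  F_add_tau u _ := by rw [quasi_add_tau hτ]; ring
  X_add_tau u := by
    rw [(pair τ hτ).weierstrassP_add_coe u ⟨τ, (pair τ hτ).ω₂_mem_lattice⟩]
  F_half := by rw [quasi_half, mul_zero]
  X_half := rfl
  Y_half := by rw [derivWeierstrassP_half, mul_zero]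
  F_pole := by
    obtain ⟨g, hg, h⟩ := removable_mul_quasi hτ
    refine ⟨fun u => c * g u, analyticAt_const.mul hg, ?_⟩
    filter_upwards [h] with u hu
    rw [← hu]; ring
  X_pole := by
    refine ⟨fun u => c ^ 2 * (u ^ 2 * (pair τ hτ).weierstrassPExcept 0 u + 1 +
      u ^ 2 * EisensteinSeries.G2 ⟨τ, hτ⟩), ?_, ?_⟩
    · have := (pair τ hτ).analyticAt_weierstrassPExcept 0
      fun_prop
    · filter_upwards [self_mem_nhdsWithin] with u hu
      have hu : u ≠ 0 := hu
      have := (pair τ hτ).weierstrassPExcept_def 0 u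
      simp only [ZeroMemClass.coe_zero] at this
      rw [this]
      field_simp
      ring
  X_tendsto := by
    have h := tendsto_weierstrassP_cobounded (pair τ hτ)
    exact (tendsto_mul_left_cobounded (pow_ne_zero 2 hc)).comp
      ((tendsto_add_const_cobounded _).comp h)

lemma isIntegral_of_cubic {x a b : ℂ} (ha : IsIntegral ℤ a) (hb : IsIntegral ℤ b)
    (h : x ^ 3 = a * x + b) : IsIntegral ℤ x := by
  let a' : integralClosure ℤ ℂ := ⟨a, ha⟩
  let b' : integralClosure ℤ ℂ := ⟨b, hb⟩
  refine isIntegral_trans (A := integralClosure ℤ ℂ) x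
    ⟨Polynomial.X ^ 3 - (Polynomial.C a' * Polynomial.X + Polynomial.C b'), ?_, ?_⟩
  · exact Polynomial.monic_X_pow_sub (Polynomial.degree_linear_le.trans_lt (by norm_num))
  · rw [← Polynomial.aeval_def]
    simp [h, a', b', Algebra.algebraMap_eq_smul_one, Subalgebra.smul_def]

lemma exists_intCast_mul_isIntegral {x : ℂ} (hx : IsAlgebraic ℚ x) :
    ∃ d : ℤ, d ≠ 0 ∧ IsIntegral ℤ (d * x) := by
  obtain ⟨d, hd, h⟩ := ((IsFractionRing.isAlgebraic_iff ℤ ℚ ℂ).mpr hx).exists_integral_multiple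
  exact ⟨d, hd, by rwa [zsmul_eq_mul] at h⟩

end EllipticZeroLocus

/-- No point of the zero locus `K` of the elliptic integral `∫ x dx/y` has all coordinates
algebraic: for every `z` in the upper half plane and every `λ ∈ ℂ*`, at least one of
`λ²g₁(z)`, `λ⁴g₂(z)`, `λ⁶g₃(z)` is transcendental over `ℚ`. -/
theorem zero_locus_no_algebraic_point (z lam : ℂ) (hz : 0 < z.im) (hlam : lam ≠ 0) :
    Transcendental ℚ (lam ^ 2 * eisG₁ z) ∨
    Transcendental ℚ (lam ^ 4 * eisG₂ z) ∨
    Transcendental ℚ (lam ^ 6 * eisG₃ z) := by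
  by_contra! h
  simp only [Transcendental, not_not] at h
  obtain ⟨h1, h2, h3⟩ := h
  obtain ⟨d₁, hd₁, i1⟩ := EllipticZeroLocus.exists_intCast_mul_isIntegral h1
  obtain ⟨d₂, hd₂, i2⟩ := EllipticZeroLocus.exists_intCast_mul_isIntegral h2
  obtain ⟨d₃, hd₃, i3⟩ := EllipticZeroLocus.exists_intCast_mul_isIntegral h3
  have hint : ∀ n : ℤ, IsIntegral ℤ (n : ℂ) := fun n => isIntegral_algebraMap (x := n)
  obtain ⟨d, hd⟩ : ∃ d, d = d₁ * d₂ * d₃ := ⟨_, rfl⟩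
  replace i1 : IsIntegral ℤ (d * (lam ^ 2 * eisG₁ z)) := by
    convert! (hint (d₂ * d₃)).mul i1 using 1
    rw [hd]; push_cast; ring
  replace i2 : IsIntegral ℤ (d * (lam ^ 4 * eisG₂ z)) := by
    convert! (hint (d₁ * d₃)).mul i2 using 1
    rw [hd]; push_cast; ring
  replace i3 : IsIntegral ℤ (d * (lam ^ 6 * eisG₃ z)) := by
    convert! (hint (d₁ * d₂)).mul i3 using 1
    rw [hd]; push_cast; ring
  replace hd : d ≠ 0 := hd ▸ mul_ne_zero (mul_ne_zero hd₁ hd₂) hd₃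
  have hdC : (d : ℂ) ≠ 0 := by exact_mod_cast hd
  have hpi : (Real.pi : ℂ) ≠ 0 := by exact_mod_cast Real.pi_ne_zero
  obtain ⟨c, hc⟩ := IsAlgClosed.exists_pow_nat_eq ((108 * d * lam) ^ 2 * I / (6 * Real.pi)) two_pos
  have hc0 : c ≠ 0 := by
    rintro rfl
    rw [eq_comm, zero_pow two_ne_zero] at hc
    simp [hdC, hlam, hpi] at hc
  have e1 : c ^ 2 * EisensteinSeries.G2 ⟨z, hz⟩ = 3888 * d * (d * (lam ^ 2 * eisG₁ z)) := by
    rw [hc, EllipticZeroLocus.eisG₁_eq hz]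
    field_simp; ring
  have e2 : c ^ 4 * (EllipticZeroLocus.pair z hz).g₂ =
      4 * (3779136 * d ^ 3) * (d * (lam ^ 4 * eisG₂ z)) := by
    rw [show c ^ 4 = (c ^ 2) ^ 2 by ring, hc, EllipticZeroLocus.eisG₂_eq hz]
    field_simp; ring_nf; simp [I_sq]
  have e3 : c ^ 6 * (EllipticZeroLocus.pair z hz).g₃ =
      4 * (14693280768 * d ^ 5) * (d * (lam ^ 6 * eisG₃ z)) := by
    rw [show c ^ 6 = (c ^ 2) ^ 3 by ring, hc, EllipticZeroLocus.eisG₃_eq hz]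
    field_simp; ring_nf; simp [I_sq]
  have hx : IsIntegral ℤ (c ^ 2 * (EllipticZeroLocus.pair z hz).weierstrassP (1 / 2)) := by
    refine EllipticZeroLocus.isIntegral_of_cubic
      (a := (3779136 * d ^ 3 : ℤ) * (d * (lam ^ 4 * eisG₂ z)))
      (b := (14693280768 * d ^ 5 : ℤ) * (d * (lam ^ 6 * eisG₃ z)))
      ((hint _).mul i2) ((hint _).mul i3) ?_
    have := (EllipticZeroLocus.pair z hz).derivWeierstrassP_sq (1 / 2)
      (EllipticZeroLocus.half_notMem_lattice hz)
    rw [EllipticZeroLocus.derivWeierstrassP_half] at this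
    push_cast
    linear_combination (-c ^ 6 / 4) * this + c ^ 2 / 4 *
      (EllipticZeroLocus.pair z hz).weierstrassP (1 / 2) * e2 + e3 / 4
  have hα : IsIntegral ℤ (c ^ 2 * EisensteinSeries.G2 ⟨z, hz⟩) := by
    rw [e1]; exact_mod_cast (hint (3888 * d)).mul i1
  have hβ : IsIntegral ℤ (c ^ 4 * (EllipticZeroLocus.pair z hz).g₂ / 2) := by
    rw [e2, show 4 * (3779136 * (d : ℂ) ^ 3) * (d * (lam ^ 4 * eisG₂ z)) / 2 =
      (2 * (3779136 * d ^ 3) : ℤ) * (d * (lam ^ 4 * eisG₂ z)) by push_cast; ring]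
    exact (hint _).mul i2
  refine (EllipticZeroLocus.quasiEllipticSystem hz hc0).false_of_isIntegral ?_ ?_ ?_
  · exact_mod_cast (hint (-12)).mul hα
  · exact_mod_cast ((hint 6).mul (hα.pow 2)).sub hβ
  · rw [mul_add]; exact hx.add hα
end
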